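/- arXiv:2011.11623 — 10 statements merged into one kernel-verified Lean document; each statement's English description precedes it below -/
import Mathlib

section
/- Let t be a nonzero complex number, u a complex number, and let A = [[t, 1], [0, t^{-1}]] and B = [[t, 0], [-u, t^{-1}]] (both of determinant 1). Let C = A·B·A^{-1}·B^{-1}, let m be an integer, and let V = C^m·A·C^{-m}·B. Set x = t + t^{-1} and y = u + 2. Then tr(C) = y^2 - x^2·y + 2x^2 - 2 and tr(V) = 2 + (x^2 - y - 2)·(S_m(α) + (1 - y)·S_{m-1}(α))^2, where α = y^2 - x^2·y + 2x^2 - 2. -/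
open Polynomial in
/-- A sequence satisfying the recurrence and initial values of the Chebyshev polynomials `S`
evaluated at `a` agrees with them. -/
theorem eq_eval_chebyshev_S {R : Type*} [CommRing R] (a : R) (f : ℤ → R)
    (h_zero : f 0 = 1) (h_one : f 1 = a) (h_rec : ∀ k, f k = a * f (k - 1) - f (k - 2)) (k : ℤ) :
    f k = (Chebyshev.S R k).eval a := by
  induction k using Chebyshev.induct with
  | zero => simp [h_zero]
  | one => simp [h_one]
  | add_two n ih₁ ih₂ =>
    have h := h_rec (n + 2)
    rw [show (n + 2 - 1 : ℤ) = n + 1 by ring, show (n + 2 - 2 : ℤ) = n by ring] at h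
    simp [Chebyshev.S_add_two, h, ih₁, ih₂]
  | neg_add_one n ih₁ ih₂ =>
    have h := h_rec (-n + 1)
    rw [show (-n + 1 - 1 : ℤ) = -n by ring, show (-n + 1 - 2 : ℤ) = -n - 1 by ring] at h
    rw [Chebyshev.S_sub_one, eval_sub, eval_mul, eval_X, ← ih₁, ← ih₂]
    linear_combination h

namespace Matrix.SpecialLinearGroup

variable {R : Type*} [CommRing R]

theorem coe_inv_fin_two (M : SpecialLinearGroup (Fin 2) R) :
    ((M⁻¹ : SpecialLinearGroup (Fin 2) R) : Matrix (Fin 2) (Fin 2) R) =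
      (M : Matrix (Fin 2) (Fin 2) R).trace • 1 - (M : Matrix (Fin 2) (Fin 2) R) := by
  rw [coe_inv, adjugate_fin_two]
  ext i j
  fin_cases i <;> fin_cases j <;> simp [trace_fin_two]

theorem coe_mul_self_fin_two (M : SpecialLinearGroup (Fin 2) R) :
    (M : Matrix (Fin 2) (Fin 2) R) * M =
      (M : Matrix (Fin 2) (Fin 2) R).trace • (M : Matrix (Fin 2) (Fin 2) R) - 1 := by
  have h := congrArg (fun N : SpecialLinearGroup (Fin 2) R => (N : Matrix (Fin 2) (Fin 2) R))
    (mul_inv_cancel M)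
  simp only [coe_mul, coe_inv_fin_two, mul_sub, mul_smul_comm, mul_one, coe_one] at h
  rw [← h]
  abel

open Polynomial in
/-- Integer powers in `SL₂` are given by Chebyshev polynomials of the trace. -/
theorem coe_zpow_fin_two (M : SpecialLinearGroup (Fin 2) R) (m : ℤ) :
    ((M ^ m : SpecialLinearGroup (Fin 2) R) : Matrix (Fin 2) (Fin 2) R) =
      (Chebyshev.S R (m - 1)).eval (M : Matrix (Fin 2) (Fin 2) R).trace •
          (M : Matrix (Fin 2) (Fin 2) R) -
        (Chebyshev.S R (m - 2)).eval (M : Matrix (Fin 2) (Fin 2) R).trace • 1 := by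
  induction m using Int.induction_on with
  | zero => simp
  | succ n ih =>
    rw [_root_.zpow_add_one, coe_mul, ih, sub_mul, smul_mul_assoc, coe_mul_self_fin_two, smul_mul_assoc,
      one_mul, show (n + 1 - 1 : ℤ) = n by ring, show (n + 1 - 2 : ℤ) = n - 1 by ring,
      Chebyshev.S_eq R n, eval_sub, eval_mul, eval_X]
    module
  | pred n ih =>
    have h := congrArg (fun N : SpecialLinearGroup (Fin 2) R => (N : Matrix (Fin 2) (Fin 2) R))
      (mul_inv_cancel M)
    simp only [coe_mul, coe_one] at h
    rw [_root_.zpow_sub_one, coe_mul, ih, sub_mul, smul_mul_assoc, h, smul_mul_assoc, one_mul,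
      coe_inv_fin_two, show (-n - 1 - 1 : ℤ) = -n - 2 by ring,
      show (-n - 1 - 2 : ℤ) = (-n - 1) - 2 by ring, Chebyshev.S_sub_two R (-n - 1),
      show (-n - 1 - 1 : ℤ) = -n - 2 by ring, eval_sub, eval_mul, eval_X]
    module

end Matrix.SpecialLinearGroup

/-- With `A = [[t, 1], [0, t⁻¹]]`, `B = [[t, 0], [-u, t⁻¹]]` (`t ≠ 0`),
`C = A B A⁻¹ B⁻¹`, `V = Cᵐ A C⁻ᵐ B`, `x = t + t⁻¹`, `y = u + 2` and
`α = y² - x² y + 2x² - 2`, one has `tr C = α` and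
`tr V = 2 + (x² - y - 2)(S_m(α) + (1 - y) S_{m-1}(α))²`. -/
theorem trace_comm_and_v
    (S : ℤ → ℂ → ℂ)
    (hS0 : ∀ z : ℂ, S 0 z = 1)
    (hS1 : ∀ z : ℂ, S 1 z = z)
    (hSrec : ∀ (k : ℤ) (z : ℂ), S k z = z * S (k - 1) z - S (k - 2) z)
    (t u : ℂ) (ht : t ≠ 0)
    (A B : Matrix.SpecialLinearGroup (Fin 2) ℂ)
    (hA : (A : Matrix (Fin 2) (Fin 2) ℂ) = !![t, 1; 0, t⁻¹])
    (hB : (B : Matrix (Fin 2) (Fin 2) ℂ) = !![t, 0; -u, t⁻¹])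
    (m : ℤ) (C V : Matrix.SpecialLinearGroup (Fin 2) ℂ)
    (hC : C = A * B * A⁻¹ * B⁻¹)
    (hV : V = C ^ m * A * C ^ (-m) * B)
    (x y α : ℂ) (hx : x = t + t⁻¹) (hy : y = u + 2)
    (hα : α = y ^ 2 - x ^ 2 * y + 2 * x ^ 2 - 2) :
    Matrix.trace (C : Matrix (Fin 2) (Fin 2) ℂ) = y ^ 2 - x ^ 2 * y + 2 * x ^ 2 - 2 ∧
    Matrix.trace (V : Matrix (Fin 2) (Fin 2) ℂ) =
      2 + (x ^ 2 - y - 2) * (S m α + (1 - y) * S (m - 1) α) ^ 2 := by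
  have hCm : (C : Matrix (Fin 2) (Fin 2) ℂ) =
      !![t, 1; 0, t⁻¹] * !![t, 0; -u, t⁻¹] * !![t⁻¹, -1; 0, t] * !![t⁻¹, 0; u, t] := by
    simp [hC, hA, hB, Matrix.adjugate_fin_two]
  have htr : Matrix.trace (C : Matrix (Fin 2) (Fin 2) ℂ) = α := by
    rw [hCm, hα, hx, hy]
    simp [Matrix.trace_fin_two]
    field_simp
    ring
  refine ⟨htr.trans hα, ?_⟩
  have hS : ∀ k, (Polynomial.Chebyshev.S ℂ k).eval α = S k α := fun k =>
    (eq_eval_chebyshev_S α (S · α) (hS0 α) (hS1 α) (hSrec · α) k).symm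
  have hpow := Matrix.SpecialLinearGroup.coe_zpow_fin_two C m
  have hinv := Matrix.SpecialLinearGroup.coe_inv_fin_two (C ^ m)
  have hsq := congrArg (Polynomial.eval α) (Polynomial.Chebyshev.S_sq_add_S_sq ℂ (m - 2))
  rw [show (m - 2 + 1 : ℤ) = m - 1 by ring] at hsq
  simp only [Polynomial.eval_sub, Polynomial.eval_add, Polynomial.eval_mul, Polynomial.eval_pow,
    Polynomial.eval_X, Polynomial.eval_one, hS] at hsq
  rw [htr, hS, hS] at hpow
  rw [hpow, Matrix.trace_sub, Matrix.trace_smul, Matrix.trace_smul, htr, Matrix.trace_one] at hinv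
  rw [hV, zpow_neg, Matrix.SpecialLinearGroup.coe_mul, Matrix.SpecialLinearGroup.coe_mul,
    Matrix.SpecialLinearGroup.coe_mul, hinv, hpow, hA, hB, hCm, hSrec m]
  generalize S (m - 1) α = p at *
  generalize S (m - 2) α = q at *
  have key : ∀ z : ℂ, z = 2 * (q ^ 2 + p ^ 2 - α * q * p) +
      (x ^ 2 - y - 2) * (α * p - q + (1 - y) * p) ^ 2 →
      z = 2 + (x ^ 2 - y - 2) * (α * p - q + (1 - y) * p) ^ 2 := by
    intro z hz
    rw [hz, hsq, mul_one]
  apply key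
  rw [hα, hx, hy]
  simp [Matrix.trace_fin_two, Matrix.mul_apply, Fin.sum_univ_two]
  field_simp
  ring
end

section
/- Let k ≥ 1 be an integer. The polynomial S_k(z) - S_{k-1}(z) has exactly k roots, namely z = 2cos(θ_j) where θ_j = (2j-1)π/(2k+1) for 1 ≤ j ≤ k. Moreover, at z = 2cos(θ_j) one has (-1)^{j+1}·S_k(z) > 0. -/
open Real

theorem chebyshev_neg_one
    {S : ℤ → ℝ → ℝ} (hS0 : ∀ z : ℝ, S 0 z = 1) (hS1 : ∀ z : ℝ, S 1 z = z)
    (hSrec : ∀ (k : ℤ) (z : ℝ), S k z = z * S (k - 1) z - S (k - 2) z)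
    (z : ℝ) : S (-1) z = 0 := by
  have h := hSrec 1 z
  norm_num [hS0, hS1] at h
  linarith

theorem chebyshev_mul_sin
    {S : ℤ → ℝ → ℝ} (hS0 : ∀ z : ℝ, S 0 z = 1) (hS1 : ∀ z : ℝ, S 1 z = z)
    (hSrec : ∀ (k : ℤ) (z : ℝ), S k z = z * S (k - 1) z - S (k - 2) z)
    (θ : ℝ) (n : ℕ) :
    S n (2 * cos θ) * sin θ = sin ((n + 1) * θ) ∧
      S (n - 1) (2 * cos θ) * sin θ = sin (n * θ) := by
  induction n with
  | zero => simp [hS0, chebyshev_neg_one hS0 hS1 hSrec]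
  | succ n ih =>
    obtain ⟨h, h'⟩ := ih
    have hr := hSrec (n + 1) (2 * cos θ)
    rw [show (n + 1 - 1 : ℤ) = n by ring, show (n + 1 - 2 : ℤ) = n - 1 by ring] at hr
    push_cast
    rw [show (n + 1 - 1 : ℤ) = n by ring]
    refine ⟨?_, h⟩
    have h₁ : sin ((n + 1 + 1) * θ) = sin ((n + 1) * θ) * cos θ + cos ((n + 1) * θ) * sin θ := by
      rw [← sin_add]; ring_nf
    have h₂ : sin (n * θ) = sin ((n + 1) * θ) * cos θ - cos ((n + 1) * θ) * sin θ := by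
      rw [← sin_sub]; ring_nf
    rw [hr]
    linear_combination 2 * cos θ * h - h' - h₁ - h₂

theorem chebyshev_sub_of_two_le
    {S : ℤ → ℝ → ℝ} (hS0 : ∀ z : ℝ, S 0 z = 1) (hS1 : ∀ z : ℝ, S 1 z = z)
    (hSrec : ∀ (k : ℤ) (z : ℝ), S k z = z * S (k - 1) z - S (k - 2) z)
    {z : ℝ} (hz : 2 ≤ z) (n : ℕ) :
    1 ≤ S n z - S (n - 1) z ∧ 0 ≤ S (n - 1) z := by
  induction n with
  | zero => simp [hS0, chebyshev_neg_one hS0 hS1 hSrec]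
  | succ n ih =>
    obtain ⟨h, h'⟩ := ih
    have hr := hSrec (n + 1) z
    rw [show (n + 1 - 1 : ℤ) = n by ring, show (n + 1 - 2 : ℤ) = n - 1 by ring] at hr
    push_cast
    rw [show (n + 1 - 1 : ℤ) = n by ring, hr]
    have hn : 0 ≤ S n z := by linarith
    exact ⟨by nlinarith, hn⟩

theorem chebyshev_add_of_le_neg_two
    {S : ℤ → ℝ → ℝ} (hS0 : ∀ z : ℝ, S 0 z = 1) (hS1 : ∀ z : ℝ, S 1 z = z)
    (hSrec : ∀ (k : ℤ) (z : ℝ), S k z = z * S (k - 1) z - S (k - 2) z)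
    {z : ℝ} (hz : z ≤ -2) (n : ℕ) :
    (1 ≤ S n z + S (n - 1) z ∧ S (n - 1) z ≤ 0) ∨
      (S n z + S (n - 1) z ≤ -1 ∧ 0 ≤ S (n - 1) z) := by
  induction n with
  | zero => simp [hS0, chebyshev_neg_one hS0 hS1 hSrec]
  | succ n ih =>
    have hr := hSrec (n + 1) z
    rw [show (n + 1 - 1 : ℤ) = n by ring, show (n + 1 - 2 : ℤ) = n - 1 by ring] at hr
    push_cast
    rw [show (n + 1 - 1 : ℤ) = n by ring, hr]
    rcases ih with ⟨h, h'⟩ | ⟨h, h'⟩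
    · have hn : 0 ≤ S n z := by linarith
      exact Or.inr ⟨by nlinarith, hn⟩
    · have hn : S n z ≤ 0 := by linarith
      exact Or.inl ⟨by nlinarith, hn⟩

theorem abs_lt_two_of_chebyshev_sub_eq_zero
    {S : ℤ → ℝ → ℝ} (hS0 : ∀ z : ℝ, S 0 z = 1) (hS1 : ∀ z : ℝ, S 1 z = z)
    (hSrec : ∀ (k : ℤ) (z : ℝ), S k z = z * S (k - 1) z - S (k - 2) z)
    {z : ℝ} {n : ℕ} (h : S n z - S (n - 1) z = 0) :
    |z| < 2 := by
  rw [abs_lt]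
  constructor <;> by_contra! hz
  · rcases chebyshev_add_of_le_neg_two hS0 hS1 hSrec hz n with ⟨_, _⟩ | ⟨_, _⟩ <;> linarith
  · linarith [chebyshev_sub_of_two_le hS0 hS1 hSrec hz n]

theorem chebyshev_sub_mul_sin
    {S : ℤ → ℝ → ℝ} (hS0 : ∀ z : ℝ, S 0 z = 1) (hS1 : ∀ z : ℝ, S 1 z = z)
    (hSrec : ∀ (k : ℤ) (z : ℝ), S k z = z * S (k - 1) z - S (k - 2) z)
    (θ : ℝ) (n : ℕ) :
    (S n (2 * cos θ) - S (n - 1) (2 * cos θ)) * sin θ =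
      2 * sin (θ / 2) * cos ((2 * n + 1) * θ / 2) := by
  obtain ⟨h, h'⟩ := chebyshev_mul_sin hS0 hS1 hSrec θ n
  rw [sub_mul, h, h', sin_sub_sin]
  ring_nf

theorem chebyshev_sub_eq_zero_iff
    {S : ℤ → ℝ → ℝ} (hS0 : ∀ z : ℝ, S 0 z = 1) (hS1 : ∀ z : ℝ, S 1 z = z)
    (hSrec : ∀ (k : ℤ) (z : ℝ), S k z = z * S (k - 1) z - S (k - 2) z)
    {θ : ℝ} (h₀ : 0 < θ) (hπ : θ < π) (n : ℕ) :
    S n (2 * cos θ) - S (n - 1) (2 * cos θ) = 0 ↔ cos ((2 * n + 1) * θ / 2) = 0 := by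
  have hs : sin θ ≠ 0 := (sin_pos_of_pos_of_lt_pi h₀ hπ).ne'
  have hs' : 2 * sin (θ / 2) ≠ 0 :=
    mul_ne_zero two_ne_zero (sin_pos_of_pos_of_lt_pi (by linarith) (by linarith)).ne'
  rw [← mul_left_inj' hs, zero_mul, chebyshev_sub_mul_sin hS0 hS1 hSrec]
  simp [hs']

theorem odd_mul_pi_div_mem_Ioo {k j : ℤ} (hj : 1 ≤ j) (hjk : j ≤ k) :
    (2 * j - 1) * π / (2 * k + 1) ∈ Set.Ioo 0 π := by
  have hj' : (1 : ℝ) ≤ j := by exact_mod_cast hj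
  have hjk' : (j : ℝ) ≤ k := by exact_mod_cast hjk
  have hk : (0 : ℝ) < 2 * k + 1 := by linarith
  constructor
  · exact div_pos (mul_pos (by linarith) pi_pos) hk
  · rw [div_lt_iff₀ hk]
    nlinarith [pi_pos]

/-- For `k ≥ 1`, the real roots of `S_k(z) - S_{k-1}(z)` are exactly the `k`
distinct numbers `z = 2 cos((2j-1)π/(2k+1))` for `1 ≤ j ≤ k`; moreover at such
a root one has `(-1)^{j+1} S_k(z) > 0`. -/
theorem chebyshev_diff_roots
    (S : ℤ → ℝ → ℝ)
    (hS0 : ∀ z : ℝ, S 0 z = 1)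
    (hS1 : ∀ z : ℝ, S 1 z = z)
    (hSrec : ∀ (k : ℤ) (z : ℝ), S k z = z * S (k - 1) z - S (k - 2) z)
    (k : ℤ) (hk : 1 ≤ k) :
    (∀ z : ℝ, S k z - S (k - 1) z = 0 ↔
      ∃ j : ℤ, 1 ≤ j ∧ j ≤ k ∧ z = 2 * Real.cos ((2 * j - 1) * π / (2 * k + 1))) ∧
    (∀ i j : ℤ, 1 ≤ i → i ≤ k → 1 ≤ j → j ≤ k →
      2 * Real.cos ((2 * i - 1) * π / (2 * k + 1)) =
        2 * Real.cos ((2 * j - 1) * π / (2 * k + 1)) → i = j) ∧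
    (∀ j : ℤ, 1 ≤ j → j ≤ k →
      (-1 : ℝ) ^ (j + 1) * S k (2 * Real.cos ((2 * j - 1) * π / (2 * k + 1))) > 0) := by
  lift k to ℕ using by omega with n
  have hn : (0 : ℝ) < 2 * n + 1 := by positivity
  simp only [Int.cast_natCast]
  refine ⟨fun z ↦ ⟨fun h ↦ ?_, ?_⟩, ?_, ?_⟩
  · have hz := abs_lt.1 (abs_lt_two_of_chebyshev_sub_eq_zero hS0 hS1 hSrec h)
    obtain ⟨θ, h₀, hπ, rfl⟩ : ∃ θ : ℝ, 0 < θ ∧ θ < π ∧ z = 2 * cos θ := by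
      refine ⟨arccos (z / 2), arccos_pos.2 (by linarith), ?_, ?_⟩
      · exact lt_of_le_of_ne (arccos_le_pi _) fun h ↦ by linarith [arccos_eq_pi.1 h]
      · rw [cos_arccos (by linarith) (by linarith)]
        ring
    rw [chebyshev_sub_eq_zero_iff hS0 hS1 hSrec h₀ hπ, cos_eq_zero_iff] at h
    obtain ⟨m, hm⟩ := h
    have hθ : (2 * n + 1) * θ = (2 * m + 1) * π := by linarith
    have hm₀ : (0 : ℝ) < 2 * m + 1 :=
      pos_of_mul_pos_left (hθ ▸ mul_pos hn h₀) pi_pos.le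
    have hmn : (2 * m + 1 : ℝ) < 2 * n + 1 :=
      lt_of_mul_lt_mul_right (hθ ▸ mul_lt_mul_of_pos_left hπ hn) pi_pos.le
    have hm₀' : 0 < 2 * m + 1 := by exact_mod_cast hm₀
    have hmn' : 2 * m + 1 < 2 * (n : ℤ) + 1 := by exact_mod_cast hmn
    refine ⟨m + 1, by omega, by omega, ?_⟩
    congr 2
    rw [eq_div_iff hn.ne']
    push_cast
    linarith
  · rintro ⟨j, hj, hjn, rfl⟩
    obtain ⟨h₀, hπ⟩ := odd_mul_pi_div_mem_Ioo hj hjn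
    simp only [Int.cast_natCast] at h₀ hπ
    rw [chebyshev_sub_eq_zero_iff hS0 hS1 hSrec h₀ hπ, cos_eq_zero_iff]
    refine ⟨j - 1, ?_⟩
    rw [mul_div_cancel₀ _ hn.ne']
    push_cast
    ring
  · intro i j hi hin hj hjn h
    have hi' := odd_mul_pi_div_mem_Ioo hi hin
    have hj' := odd_mul_pi_div_mem_Ioo hj hjn
    simp only [Int.cast_natCast] at hi' hj'
    have h' := injOn_cos (Set.Ioo_subset_Icc_self hi') (Set.Ioo_subset_Icc_self hj')
      (mul_left_cancel₀ two_ne_zero h)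
    rw [div_left_inj' hn.ne', mul_left_inj' pi_ne_zero] at h'
    have h'' : (i : ℝ) = j := by linarith
    exact_mod_cast h''
  · intro j hj hjn
    obtain ⟨h₀, hπ⟩ := odd_mul_pi_div_mem_Ioo hj hjn
    simp only [Int.cast_natCast] at h₀ hπ
    have hθ := mul_div_cancel₀ ((2 * j - 1) * π) hn.ne'
    generalize (2 * j - 1) * π / (2 * n + 1) = θ at h₀ hπ hθ ⊢
    have h := (chebyshev_mul_sin hS0 hS1 hSrec θ n).1
    rw [show (n + 1) * θ = j * π - (π - θ) / 2 by linarith, sin_int_mul_pi_sub] at h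
    refine pos_of_mul_pos_left (b := sin θ) ?_ (sin_pos_of_pos_of_lt_pi h₀ hπ).le
    rw [mul_assoc, h, zpow_add_one₀ (by norm_num)]
    have hsq : ((-1 : ℝ) ^ j) * (-1) ^ j = 1 := by
      rw [← mul_zpow]
      norm_num
    have hpos : 0 < sin ((π - θ) / 2) := sin_pos_of_pos_of_lt_pi (by linarith) (by linarith)
    linear_combination hpos - sin ((π - θ) / 2) * hsq
end

section
/- Fix a real number x and nonzero integers n and m. As y → ∞, the real-valued function (-1)^n·R_{n,m}(x,y) tends to -∞ if n ≥ 1 and m ≥ 1; tends to +∞ if n ≥ 1 and m ≤ -1; tends to +∞ if n ≤ -1 and m ≥ 1; and tends to -∞ if n ≤ -1 and m ≤ -1. -/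
open Real

/-- `α = y² - x² y + 2x² - 2`. -/
noncomputable def chebAlpha (x y : ℝ) : ℝ := y ^ 2 - x ^ 2 * y + 2 * x ^ 2 - 2

/-- `β = 2 + (x² - y - 2)(S_m(α) + (1 - y) S_{m-1}(α))²`. -/
noncomputable def chebBeta (S : ℤ → ℝ → ℝ) (m : ℤ) (x y : ℝ) : ℝ :=
  2 + (x ^ 2 - y - 2) *
    (S m (chebAlpha x y) + (1 - y) * S (m - 1) (chebAlpha x y)) ^ 2

/-- The Riley polynomial `R_{n,m}(x,y)` of the rational knot `C(2n+1, 2m, 2)`. -/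
noncomputable def RileyR (S : ℤ → ℝ → ℝ) (n m : ℤ) (x y : ℝ) : ℝ :=
  ((x ^ 2 - y - 1) * S m (chebAlpha x y) - S (m - 1) (chebAlpha x y)) *
      S n (chebBeta S m x y) -
    ((x ^ 2 - y - 1) * S (m - 1) (chebAlpha x y) - S (m - 2) (chebAlpha x y)) *
      S (n - 1) (chebBeta S m x y)

open Filter Topology Polynomial

/-- `f y / y ^ k → c` as `y → ∞`; if `c ≠ 0`, then `c * y ^ k` is the leading term of `f`. -/
def HasLead (f : ℝ → ℝ) (c : ℝ) (k : ℤ) : Prop :=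
  Tendsto (fun y => f y / y ^ k) atTop (𝓝 c)

namespace HasLead

variable {f g : ℝ → ℝ} {c d : ℝ} {k l : ℤ}

lemma add (hf : HasLead f c k) (hg : HasLead g d k) :
    HasLead (fun y => f y + g y) (c + d) k := by
  simpa only [HasLead, add_div] using Tendsto.add hf hg

lemma neg (hf : HasLead f c k) : HasLead (fun y => -f y) (-c) k := by
  simpa only [HasLead, neg_div] using Tendsto.neg hf

lemma mul (hf : HasLead f c k) (hg : HasLead g d l) :
    HasLead (fun y => f y * g y) (c * d) (k + l) := by
  refine Tendsto.congr' ?_ (Tendsto.mul hf hg)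
  filter_upwards [eventually_gt_atTop 0] with y hy
  rw [zpow_add₀ hy.ne', div_mul_div_comm]

lemma const (c : ℝ) : HasLead (fun _ => c) c 0 := by
  simp [HasLead]

lemma id : HasLead (fun y => y) 1 1 := by
  refine Tendsto.congr' ?_ tendsto_const_nhds
  filter_upwards [eventually_gt_atTop 0] with y hy
  rw [zpow_one, div_self hy.ne']

lemma of_lt (hf : HasLead f c k) (hkl : k < l) : HasLead f 0 l := by
  have h : Tendsto (fun y : ℝ => y ^ (k - l)) atTop (𝓝 0) := tendsto_zpow_atTop_zero (by lia)
  have := Tendsto.mul hf h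
  rw [mul_zero] at this
  refine this.congr' ?_
  filter_upwards [eventually_gt_atTop 0] with y hy
  rw [zpow_sub₀ hy.ne']
  field_simp

lemma add_of_lt (hf : HasLead f c k) (hg : HasLead g d l) (hlk : l < k) :
    HasLead (fun y => f y + g y) c k := by
  simpa using hf.add (hg.of_lt hlk)

lemma sub_of_lt (hf : HasLead f c k) (hg : HasLead g d l) (hlk : l < k) :
    HasLead (fun y => f y - g y) c k := by
  simpa only [sub_eq_add_neg] using hf.add_of_lt hg.neg hlk

lemma congr (hf : HasLead f c k) (hfg : ∀ y, f y = g y) (hcd : c = d) (hkl : k = l) :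
    HasLead g d l := by
  obtain rfl : f = g := funext hfg
  subst hcd hkl
  exact hf

lemma tendsto_atTop (hf : HasLead f c k) (hc : 0 < c) (hk : 0 < k) :
    Tendsto f atTop atTop := by
  refine (Tendsto.pos_mul_atTop hc hf (tendsto_zpow_atTop_atTop hk)).congr' ?_
  filter_upwards [eventually_gt_atTop 0] with y hy
  exact div_mul_cancel₀ _ (zpow_ne_zero _ hy.ne')

lemma tendsto_atBot (hf : HasLead f c k) (hc : c < 0) (hk : 0 < k) :
    Tendsto f atTop atBot := by
  simpa [Function.comp_def] using tendsto_neg_atTop_atBot.comp (hf.neg.tendsto_atTop (neg_pos.2 hc) hk)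

lemma eval_chebyshevS (hf : HasLead f c k) (hk : 0 < k) (n : ℕ) :
    HasLead (fun y => (Chebyshev.S ℝ n).eval (f y)) (c ^ n) (k * n) := by
  induction n using Nat.twoStepInduction with
  | zero => simpa using const 1
  | one => simpa using hf
  | more n ih₀ ih₁ =>
    refine ((hf.mul ih₁).sub_of_lt ih₀ ?_).congr (fun y => ?_) (by ring) (by push_cast; ring)
    · push_cast
      nlinarith
    · push_cast
      simp [Chebyshev.S_add_two]

lemma eval_chebyshevS_sub_one (hf : HasLead f c k) (hk : 0 < k) (n : ℕ)
    (hl : k * (n - 1) < l) : HasLead (fun y => (Chebyshev.S ℝ (n - 1)).eval (f y)) 0 l := by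
  cases n with
  | zero => simp [HasLead]
  | succ n =>
    push_cast at hl ⊢
    rw [add_sub_cancel_right] at hl ⊢
    exact (hf.eval_chebyshevS hk n).of_lt hl

end HasLead

lemma eq_eval_chebyshevS {S : ℤ → ℝ → ℝ} (hS0 : ∀ z, S 0 z = 1) (hS1 : ∀ z, S 1 z = z)
    (hSrec : ∀ (k : ℤ) (z : ℝ), S k z = z * S (k - 1) z - S (k - 2) z) :
    S = fun k z => (Chebyshev.S ℝ k).eval z := by
  ext k z
  induction k using Chebyshev.induct with
  | zero => simp [hS0]
  | one => simp [hS1]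
  | add_two n h₁ h₀ =>
    have h := hSrec (n + 2) z
    rw [show (n : ℤ) + 2 - 1 = n + 1 by ring, add_sub_cancel_right] at h
    rw [h, h₁, h₀, Chebyshev.S_add_two]
    simp
  | neg_add_one n h₀ h₁ =>
    have h := hSrec (-n + 1) z
    rw [add_sub_cancel_right, show -(n : ℤ) + 1 - 2 = -n - 1 by ring] at h
    rw [show S (-n - 1) z = z * S (-n) z - S (-n + 1) z by linarith, h₀, h₁, Chebyshev.S_sub_one]
    simp

section Combination

variable {A B b : ℝ → ℝ} {a c : ℝ} {i j D : ℤ}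

lemma hasLead_combination_of_pos (hA : HasLead A a i) (hB : HasLead B c j)
    (hb : HasLead b (-1) D) (hD : 0 < D) (hij : j < i + D) (q : ℕ) :
    HasLead (fun y => (-1) ^ (q + 1 : ℤ) * (A y * (Chebyshev.S ℝ (q + 1)).eval (b y) -
      B y * (Chebyshev.S ℝ (q + 1 - 1)).eval (b y))) a (i + D * (q + 1)) := by
  have h := (hA.mul (hb.eval_chebyshevS hD (q + 1))).sub_of_lt
    (hB.mul (hb.eval_chebyshevS hD q)) (by push_cast; linarith)
  refine ((HasLead.const ((-1) ^ (q + 1))).mul h).congr (fun y => ?_) ?_ (by push_cast; ring)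
  · rw [add_sub_cancel_right]
    norm_cast
  · rw [mul_left_comm, ← mul_pow]
    simp

lemma hasLead_combination_of_neg (hA : HasLead A a i) (hB : HasLead B c j)
    (hb : HasLead b (-1) D) (hD : 0 < D) (hij : i < j + D) (q : ℕ) :
    HasLead (fun y => (-1) ^ (-(q + 1) : ℤ) * (A y * (Chebyshev.S ℝ (-(q + 1))).eval (b y) -
      B y * (Chebyshev.S ℝ (-(q + 1) - 1)).eval (b y))) (-c) (j + D * q) := by
  have hS := hb.eval_chebyshevS_sub_one hD q (l := j + D * q - i) (by linarith)
  have h := (hB.mul (hb.eval_chebyshevS hD q)).add ((hA.mul hS).neg.congr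
    (fun _ => rfl) rfl (add_sub_cancel i (j + D * q)))
  refine ((HasLead.const ((-1) ^ (q + 1))).mul h).congr (fun y => ?_) ?_ (by ring)
  · rw [Chebyshev.S_neg_sub_one, Chebyshev.S_neg, zpow_neg, ← inv_zpow,
      show (q : ℤ) + 1 - 2 = q - 1 by ring, add_sub_cancel_right, eval_neg, eval_neg,
      inv_neg_one]
    norm_cast
    ring
  · have : ((-1 : ℝ) ^ q) ^ 2 = 1 := by rw [← pow_mul, mul_comm, pow_mul]; simp
    linear_combination (-c) * this

end Combination

lemma hasLead_chebAlpha (x : ℝ) : HasLead (chebAlpha x) 1 2 := by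
  have h₁ := (HasLead.id.mul HasLead.id).sub_of_lt ((HasLead.const (x ^ 2)).mul HasLead.id)
    (by norm_num)
  refine (h₁.add_of_lt (HasLead.const (2 * x ^ 2 - 2)) (by norm_num)).congr (fun y => ?_)
    (by norm_num) (by norm_num)
  unfold chebAlpha
  ring

lemma hasLead_const_sub_id (t : ℝ) : HasLead (fun y => t - y) (-1) 1 := by
  refine (HasLead.id.neg.add_of_lt (HasLead.const t) (by norm_num)).congr (fun y => ?_) rfl rfl
  ring

lemma hasLead_chebBeta {S : ℤ → ℝ → ℝ} {m : ℤ} {x : ℝ} {k : ℤ} (hk : 0 ≤ k)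
    (h : HasLead (fun y => S m (chebAlpha x y) + (1 - y) * S (m - 1) (chebAlpha x y)) 1 k) :
    HasLead (chebBeta S m x) (-1) (2 * k + 1) := by
  refine (((hasLead_const_sub_id (x ^ 2 - 2)).mul (h.mul h)).add_of_lt (HasLead.const 2)
    (by linarith)).congr (fun y => ?_) (by norm_num) (by ring)
  unfold chebBeta
  ring

section Coefficients

/-- The coefficient of `S_n(β)` in `R_{n,m}` is `rileyCoeff x m`,
and that of `S_{n-1}(β)` is `-rileyCoeff x (m - 1)`. -/
noncomputable def rileyCoeff (x : ℝ) (m : ℤ) (y : ℝ) : ℝ :=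
  (x ^ 2 - y - 1) * (Chebyshev.S ℝ m).eval (chebAlpha x y) -
    (Chebyshev.S ℝ (m - 1)).eval (chebAlpha x y)

variable (x : ℝ) (p : ℕ)

lemma hasLead_rileyCoeff : HasLead (rileyCoeff x p) (-1) (2 * p + 1) := by
  have hα := hasLead_chebAlpha x
  refine (((hasLead_const_sub_id (x ^ 2 - 1)).mul (hα.eval_chebyshevS two_pos p)).sub_of_lt
    (hα.eval_chebyshevS_sub_one two_pos p (l := 2 * p) (by linarith)) (by linarith)).congr
    (fun y => ?_) (by simp) (by ring)
  unfold rileyCoeff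
  ring

lemma hasLead_rileyCoeff_neg : HasLead (rileyCoeff x (-(p + 1))) 1 (2 * p) := by
  have hα := hasLead_chebAlpha x
  have h := (hasLead_const_sub_id (x ^ 2 - 1)).mul
    (hα.eval_chebyshevS_sub_one two_pos p (l := 2 * p - 1) (by linarith))
  refine ((hα.eval_chebyshevS two_pos p).add (h.neg.congr (fun _ => rfl) rfl
    (add_sub_cancel 1 (2 * (p : ℤ))))).congr (fun y => ?_) (by simp) rfl
  rw [rileyCoeff, Chebyshev.S_neg_sub_one, Chebyshev.S_neg,
    show (p : ℤ) + 1 - 2 = p - 1 by ring, add_sub_cancel_right, eval_neg, eval_neg]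
  ring

lemma hasLead_chebBeta_of_pos :
    HasLead (chebBeta (fun k z => (Chebyshev.S ℝ k).eval z) (p + 1) x) (-1) (4 * p + 5) := by
  have hα := hasLead_chebAlpha x
  refine (hasLead_chebBeta (k := 2 * p + 2) (by positivity) ?_).congr (fun _ => rfl) rfl (by ring)
  refine ((hα.eval_chebyshevS two_pos (p + 1)).add_of_lt
    ((hasLead_const_sub_id 1).mul (hα.eval_chebyshevS two_pos p))
    (by push_cast; linarith)).congr (fun y => ?_) (by simp) (by push_cast; ring)
  rw [add_sub_cancel_right]
  norm_cast

lemma hasLead_chebBeta_of_neg :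
    HasLead (chebBeta (fun k z => (Chebyshev.S ℝ k).eval z) (-(p + 1)) x) (-1) (4 * p + 3) := by
  have hα := hasLead_chebAlpha x
  refine (hasLead_chebBeta (k := 2 * p + 1) (by positivity) ?_).congr (fun _ => rfl) rfl (by ring)
  refine (((hasLead_const_sub_id 1).mul (hα.eval_chebyshevS two_pos p)).neg.sub_of_lt
    (hα.eval_chebyshevS_sub_one two_pos p (l := 2 * p) (by linarith)) (by linarith)).congr
    (fun y => ?_) (by simp) (by ring)
  rw [Chebyshev.S_neg_sub_one, Chebyshev.S_neg,
    show (p : ℤ) + 1 - 2 = p - 1 by ring, add_sub_cancel_right, eval_neg, eval_neg]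
  ring

end Coefficients

lemma rileyR_chebyshevS (n m : ℤ) (x y : ℝ) :
    RileyR (fun k z => (Chebyshev.S ℝ k).eval z) n m x y =
      rileyCoeff x m y *
          (Chebyshev.S ℝ n).eval (chebBeta (fun k z => (Chebyshev.S ℝ k).eval z) m x y) -
        rileyCoeff x (m - 1) y *
          (Chebyshev.S ℝ (n - 1)).eval (chebBeta (fun k z => (Chebyshev.S ℝ k).eval z) m x y) := by
  rw [RileyR, rileyCoeff, rileyCoeff, show m - 1 - 1 = m - 2 by ring]

/-- For fixed real `x` and nonzero integers `n`, `m`, as `y → ∞` the function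
`(-1)^n R_{n,m}(x,y)` tends to `-∞` if `n ≥ 1, m ≥ 1`; to `+∞` if `n ≥ 1, m ≤ -1`;
to `+∞` if `n ≤ -1, m ≥ 1`; and to `-∞` if `n ≤ -1, m ≤ -1`. -/
theorem riley_limit_sign
    (S : ℤ → ℝ → ℝ)
    (hS0 : ∀ z : ℝ, S 0 z = 1)
    (hS1 : ∀ z : ℝ, S 1 z = z)
    (hSrec : ∀ (k : ℤ) (z : ℝ), S k z = z * S (k - 1) z - S (k - 2) z)
    (x : ℝ) (n m : ℤ) (hn : n ≠ 0) (hm : m ≠ 0) :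
    (1 ≤ n → 1 ≤ m →
      Filter.Tendsto (fun y : ℝ => (-1 : ℝ) ^ n * RileyR S n m x y)
        Filter.atTop Filter.atBot) ∧
    (1 ≤ n → m ≤ -1 →
      Filter.Tendsto (fun y : ℝ => (-1 : ℝ) ^ n * RileyR S n m x y)
        Filter.atTop Filter.atTop) ∧
    (n ≤ -1 → 1 ≤ m →
      Filter.Tendsto (fun y : ℝ => (-1 : ℝ) ^ n * RileyR S n m x y)
        Filter.atTop Filter.atTop) ∧
    (n ≤ -1 → m ≤ -1 →
      Filter.Tendsto (fun y : ℝ => (-1 : ℝ) ^ n * RileyR S n m x y)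
        Filter.atTop Filter.atBot) := by
  obtain rfl := eq_eval_chebyshevS hS0 hS1 hSrec
  simp only [rileyR_chebyshevS]
  have exists_of_pos : ∀ k : ℤ, 1 ≤ k → ∃ q : ℕ, k = q + 1 :=
    fun k hk => ⟨(k - 1).toNat, by lia⟩
  have exists_of_neg : ∀ k : ℤ, k ≤ -1 → ∃ q : ℕ, k = -(q + 1) :=
    fun k hk => ⟨(-k - 1).toNat, by lia⟩
  have coeff_pos (p : ℕ) : HasLead (rileyCoeff x (p + 1)) (-1) (2 * p + 3) := by
    refine (hasLead_rileyCoeff x (p + 1)).congr (fun y => ?_) rfl (by push_cast; ring)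
    push_cast
    rfl
  have coeff_pos_sub_one (p : ℕ) : HasLead (rileyCoeff x (p + 1 - 1)) (-1) (2 * p + 1) := by
    rw [add_sub_cancel_right]
    exact hasLead_rileyCoeff x p
  have coeff_neg_sub_one (p : ℕ) : HasLead (rileyCoeff x (-(p + 1) - 1)) 1 (2 * p + 2) := by
    refine (hasLead_rileyCoeff_neg x (p + 1)).congr (fun y => ?_) rfl (by push_cast; ring)
    rw [show -((p + 1 : ℕ) + 1 : ℤ) = -(p + 1) - 1 by push_cast; ring]
  refine ⟨fun hn hm => ?_, fun hn hm => ?_, fun hn hm => ?_, fun hn hm => ?_⟩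
  · obtain ⟨q, rfl⟩ := exists_of_pos n hn
    obtain ⟨p, rfl⟩ := exists_of_pos m hm
    exact (hasLead_combination_of_pos (coeff_pos p) (coeff_pos_sub_one p)
      (hasLead_chebBeta_of_pos x p) (by positivity) (by lia) q).tendsto_atBot
      (by norm_num) (by positivity)
  · obtain ⟨q, rfl⟩ := exists_of_pos n hn
    obtain ⟨p, rfl⟩ := exists_of_neg m hm
    exact (hasLead_combination_of_pos (hasLead_rileyCoeff_neg x p) (coeff_neg_sub_one p)
      (hasLead_chebBeta_of_neg x p) (by positivity) (by lia) q).tendsto_atTop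
      (by norm_num) (by positivity)
  · obtain ⟨q, rfl⟩ := exists_of_neg n hn
    obtain ⟨p, rfl⟩ := exists_of_pos m hm
    exact (hasLead_combination_of_neg (coeff_pos p) (coeff_pos_sub_one p)
      (hasLead_chebBeta_of_pos x p) (by positivity) (by lia) q).tendsto_atTop
      (by norm_num) (by positivity)
  · obtain ⟨q, rfl⟩ := exists_of_neg n hn
    obtain ⟨p, rfl⟩ := exists_of_neg m hm
    exact (hasLead_combination_of_neg (hasLead_rileyCoeff_neg x p) (coeff_neg_sub_one p)
      (hasLead_chebBeta_of_neg x p) (by positivity) (by lia) q).tendsto_atBot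
      (by norm_num) (by positivity)
end

section
/- Let x, y be real numbers and m, n integers, and suppose S_n(β) = S_{n-1}(β). Then R_{n,m}(x,y) = (x^2 - y - 2)·(S_m(α) + (1 - y)·S_{m-1}(α))·S_n(β). -/
open Real

/-- If `S_n(β) = S_{n-1}(β)` then
`R_{n,m}(x,y) = (x² - y - 2)(S_m(α) + (1 - y) S_{m-1}(α)) S_n(β)`. -/
theorem riley_simplify
    (S : ℤ → ℝ → ℝ)
    (hS0 : ∀ z : ℝ, S 0 z = 1)
    (hS1 : ∀ z : ℝ, S 1 z = z)
    (hSrec : ∀ (k : ℤ) (z : ℝ), S k z = z * S (k - 1) z - S (k - 2) z)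
    (x y : ℝ) (m n : ℤ)
    (h : S n (chebBeta S m x y) = S (n - 1) (chebBeta S m x y)) :
    RileyR S n m x y =
      (x ^ 2 - y - 2) *
        (S m (chebAlpha x y) + (1 - y) * S (m - 1) (chebAlpha x y)) *
        S n (chebBeta S m x y) := by
  have hm : S (m - 2) (chebAlpha x y) =
      chebAlpha x y * S (m - 1) (chebAlpha x y) - S m (chebAlpha x y) := by
    linarith [hSrec m (chebAlpha x y)]
  have hα : chebAlpha x y - (x ^ 2 - y) = (x ^ 2 - y - 2) * (1 - y) := by
    rw [chebAlpha]
    ring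
  rw [RileyR, ← h, hm]
  linear_combination S (m - 1) (chebAlpha x y) * S n (chebBeta S m x y) * hα
end

section
/- Let x be a real number, m, n integers, and set y = 2. Then α = 2, β = x^2 - 2, and R_{n,m}(x,2) = m·(β - 2)·(S_n(β) - S_{n-1}(β)) + S_{n+1}(β) - S_n(β). Moreover, if in addition x = 2cos θ for some real θ that is not an integer multiple of π/2, then R_{n,m}(x,2) = m·(2cos 2θ - 2)·cos((2n+1)θ)/cos θ + cos((2n+3)θ)/cos θ. -/
open Real

/-- A family satisfying the Chebyshev recursion on `ℤ` is the family of polynomials `S`. -/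
theorem eq_eval_chebyshev_S_s9 (S : ℤ → ℝ → ℝ)
    (hS0 : ∀ z : ℝ, S 0 z = 1)
    (hS1 : ∀ z : ℝ, S 1 z = z)
    (hSrec : ∀ (k : ℤ) (z : ℝ), S k z = z * S (k - 1) z - S (k - 2) z)
    (k : ℤ) (z : ℝ) : S k z = (Polynomial.Chebyshev.S ℝ k).eval z := by
  induction k using Polynomial.Chebyshev.induct with
  | zero => simp [hS0]
  | one => simp [hS1]
  | add_two n ih1 ih0 =>
    have h := hSrec (n + 2) z
    rw [show (n : ℤ) + 2 - 1 = n + 1 by ring, show (n : ℤ) + 2 - 2 = n by ring] at h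
    rw [h, ih1, ih0, Polynomial.Chebyshev.S_add_two]
    simp
  | neg_add_one n ih0 ih1 =>
    have h := hSrec (-n + 1) z
    rw [show -(n : ℤ) + 1 - 1 = -n by ring, show -(n : ℤ) + 1 - 2 = -n - 1 by ring] at h
    rw [Polynomial.Chebyshev.S_sub_one, Polynomial.eval_sub, Polynomial.eval_mul,
      Polynomial.eval_X, ← ih0, ← ih1]
    linarith

/-- Consecutive values of `S` at `2 cos 2θ` differ by `cos ((2n+1)θ) / cos θ`. -/
theorem chebyshev_S_eval_sub_eval (n : ℤ) {θ : ℝ} (hs : sin θ ≠ 0) (hc : cos θ ≠ 0) :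
    (Polynomial.Chebyshev.S ℝ n).eval (2 * cos (2 * θ)) -
      (Polynomial.Chebyshev.S ℝ (n - 1)).eval (2 * cos (2 * θ)) =
        cos ((2 * n + 1) * θ) / cos θ := by
  have h₁ := Polynomial.Chebyshev.S_two_mul_real_cos (2 * θ) n
  have h₀ := Polynomial.Chebyshev.S_two_mul_real_cos (2 * θ) (n - 1)
  push_cast at h₀
  rw [show ((n : ℝ) + 1) * (2 * θ) = (2 * n + 1) * θ + θ by ring, sin_add,
    sin_two_mul] at h₁
  rw [show ((n : ℝ) - 1 + 1) * (2 * θ) = (2 * n + 1) * θ - θ by ring, sin_sub,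
    sin_two_mul] at h₀
  rw [eq_div_iff hc]
  apply mul_left_cancel₀ (mul_ne_zero two_ne_zero hs)
  linear_combination h₁ - h₀

/-- At `y = 2`: `α = 2`, `β = x² - 2`, and
`R_{n,m}(x,2) = m (β - 2)(S_n(β) - S_{n-1}(β)) + S_{n+1}(β) - S_n(β)`.
If moreover `x = 2 cos θ` with `θ` not an integer multiple of `π/2`, then
`R_{n,m}(x,2) = m (2 cos 2θ - 2) cos((2n+1)θ)/cos θ + cos((2n+3)θ)/cos θ`. -/
theorem riley_at_y_two
    (S : ℤ → ℝ → ℝ)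
    (hS0 : ∀ z : ℝ, S 0 z = 1)
    (hS1 : ∀ z : ℝ, S 1 z = z)
    (hSrec : ∀ (k : ℤ) (z : ℝ), S k z = z * S (k - 1) z - S (k - 2) z)
    (x : ℝ) (m n : ℤ) :
    chebAlpha x 2 = 2 ∧
    chebBeta S m x 2 = x ^ 2 - 2 ∧
    RileyR S n m x 2 =
      (m : ℝ) * ((x ^ 2 - 2) - 2) * (S n (x ^ 2 - 2) - S (n - 1) (x ^ 2 - 2)) +
        S (n + 1) (x ^ 2 - 2) - S n (x ^ 2 - 2) ∧
    (∀ θ : ℝ, (∀ l : ℤ, θ ≠ l * (π / 2)) → x = 2 * Real.cos θ →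
      RileyR S n m x 2 =
        (m : ℝ) * (2 * Real.cos (2 * θ) - 2) *
            (Real.cos ((2 * n + 1) * θ) / Real.cos θ) +
          Real.cos ((2 * n + 3) * θ) / Real.cos θ) := by
  have hα : chebAlpha x 2 = 2 := by unfold chebAlpha; ring
  have hS := eq_eval_chebyshev_S_s9 S hS0 hS1 hSrec
  have hS2 (k : ℤ) : S k 2 = k + 1 := by rw [hS, Polynomial.Chebyshev.S_eval_two]
  have hβ : chebBeta S m x 2 = x ^ 2 - 2 := by
    rw [chebBeta, hα, hS2, hS2]
    push_cast
    ring
  have hR : RileyR S n m x 2 =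
      (m : ℝ) * ((x ^ 2 - 2) - 2) * (S n (x ^ 2 - 2) - S (n - 1) (x ^ 2 - 2)) +
        S (n + 1) (x ^ 2 - 2) - S n (x ^ 2 - 2) := by
    have h := hSrec (n + 1) (x ^ 2 - 2)
    rw [add_sub_cancel_right, show n + 1 - 2 = n - 1 by ring] at h
    rw [RileyR, hβ, hα, hS2, hS2, hS2, h]
    push_cast
    ring
  refine ⟨hα, hβ, hR, fun θ hθ hx => ?_⟩
  have hs : sin θ ≠ 0 := fun h => by
    obtain ⟨k, hk⟩ := sin_eq_zero_iff.mp h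
    refine hθ (2 * k) ?_
    push_cast
    linarith
  have hc : cos θ ≠ 0 := fun h => by
    obtain ⟨k, hk⟩ := cos_eq_zero_iff.mp h
    refine hθ (2 * k + 1) ?_
    push_cast
    linarith
  have hx2 : x ^ 2 - 2 = 2 * cos (2 * θ) := by rw [hx, cos_two_mul]; ring
  have h₁ := chebyshev_S_eval_sub_eval (n + 1) hs hc
  rw [add_sub_cancel_right, show (2 * ((n + 1 : ℤ) : ℝ) + 1) = 2 * n + 3 by push_cast; ring] at h₁
  rw [hR, hx2, hS, hS, hS, chebyshev_S_eval_sub_eval n hs hc, add_sub_assoc, h₁]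
end

section
/- Let m ≥ 1 be an integer, and let x, y be real numbers with y > 2 and x^2 ≤ 4. Set α = y^2 - x^2·y + 2x^2 - 2. Then S_m(α) + (1 - y)·S_{m-1}(α) > 0. -/
open Real

/-- If `u > 0` and `u (z - u) ≥ 1`, then `S_m(z) > u S_{m-1}(z) > 0` for all `m ≥ 1`. -/
lemma chebyshev_ratio_gt (S : ℤ → ℝ → ℝ)
    (hS0 : ∀ z : ℝ, S 0 z = 1)
    (hS1 : ∀ z : ℝ, S 1 z = z)
    (hSrec : ∀ (k : ℤ) (z : ℝ), S k z = z * S (k - 1) z - S (k - 2) z)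
    {z u : ℝ} (hu : 0 < u) (hzu : 1 ≤ u * (z - u)) {m : ℤ} (hm : 1 ≤ m) :
    0 < S (m - 1) z ∧ u * S (m - 1) z < S m z := by
  induction m, hm using Int.leInduction with
  | base =>
    have hpos : 0 < z - u := pos_of_mul_pos_right (zero_lt_one.trans_le hzu) hu.le
    simp only [sub_self, hS0, hS1]
    constructor <;> linarith
  | succ k hk ih =>
    obtain ⟨hpos, hlt⟩ := ih
    have hSk : 0 < S k z := (mul_pos hu hpos).trans hlt
    have hrec : S (k + 1) z = z * S k z - S (k - 1) z := by
      rw [hSrec (k + 1), add_sub_cancel_right, show k + 1 - 2 = k - 1 by ring]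
    rw [add_sub_cancel_right, hrec]
    refine ⟨hSk, lt_of_mul_lt_mul_left ?_ hu.le⟩
    nlinarith [mul_le_mul_of_nonneg_right hzu hSk.le]

lemma one_le_mul_chebAlpha_sub {x y : ℝ} (hy : 2 < y) (hx : x ^ 2 ≤ 4) :
    1 ≤ (y - 1) * (chebAlpha x y - (y - 1)) := by
  have hα : (y - 2) ^ 2 + 2 ≤ chebAlpha x y := by
    unfold chebAlpha
    nlinarith
  have hcube : 0 < (y - 2) ^ 3 := pow_pos (by linarith) 3
  nlinarith [mul_le_mul_of_nonneg_left hα (by linarith : 0 ≤ y - 1)]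

/-- For `m ≥ 1`, `y > 2` and `x² ≤ 4`, with `α = y² - x² y + 2x² - 2` one has
`S_m(α) + (1 - y) S_{m-1}(α) > 0`. -/
theorem chebyshev_alpha_sign
    (S : ℤ → ℝ → ℝ)
    (hS0 : ∀ z : ℝ, S 0 z = 1)
    (hS1 : ∀ z : ℝ, S 1 z = z)
    (hSrec : ∀ (k : ℤ) (z : ℝ), S k z = z * S (k - 1) z - S (k - 2) z)
    (m : ℤ) (hm : 1 ≤ m) (x y : ℝ) (hy : 2 < y) (hx : x ^ 2 ≤ 4) :
    0 < S m (chebAlpha x y) + (1 - y) * S (m - 1) (chebAlpha x y) := by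
  have h := (chebyshev_ratio_gt S hS0 hS1 hSrec (by linarith : 0 < y - 1)
    (one_le_mul_chebAlpha_sub hy hx) hm).2
  linarith
end

section
/- Let n ≥ 1 and m ≥ 1 be integers, and let x be a real number with 4 ≥ x^2 > 2 + 2cos((2n-1)π/(2n+1)). Then there exists a real number y > 2 such that R_{n,m}(x,y) = 0. -/
open Real

namespace Polynomial.Chebyshev

theorem S_eval_eq (k : ℤ) (z : ℝ) :
    (S ℝ k).eval z = z * (S ℝ (k - 1)).eval z - (S ℝ (k - 2)).eval z := by
  conv_lhs => rw [S_eq]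
  simp

theorem eq_S_eval {f : ℤ → ℝ → ℝ} (h0 : ∀ z, f 0 z = 1) (h1 : ∀ z, f 1 z = z)
    (hrec : ∀ k z, f k z = z * f (k - 1) z - f (k - 2) z) :
    f = fun k z => (S ℝ k).eval z := by
  funext k z
  induction k using Polynomial.Chebyshev.induct with
  | zero => simp [h0]
  | one => simp [h1]
  | add_two n ih1 ih0 =>
    rw [hrec, S_eval_eq, show (n : ℤ) + 2 - 1 = n + 1 by ring, add_sub_cancel_right, ih1, ih0]
  | neg_add_one n ih0 ih1 =>
    have h := hrec (-n + 1) z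
    have h' := S_eval_eq (-n + 1) z
    rw [show -(n : ℤ) + 1 - 1 = -n by ring, show -(n : ℤ) + 1 - 2 = -n - 1 by ring] at h h'
    rw [ih0, ih1] at h
    linarith

theorem S_eval_neg (k : ℤ) (z : ℝ) : (S ℝ k).eval (-z) = (-1) ^ k * (S ℝ k).eval z := by
  have h := eq_S_eval (f := fun k z => (-1 : ℝ) ^ k * (S ℝ k).eval (-z)) (by simp) (by simp)
    fun k z => by
      have h1 : (-1 : ℝ) ^ k = -(-1) ^ (k - 1) := by
        rw [zpow_sub_one₀ (by norm_num)]; norm_num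
      have h2 : (-1 : ℝ) ^ (k - 1) = -(-1) ^ (k - 2) := by
        rw [show k - 2 = k - 1 - 1 by ring, zpow_sub_one₀ (n := k - 1) (by norm_num)]; norm_num
      rw [S_eval_eq k (-z), h1, h2]
      ring
  simpa using (congrFun (congrFun h k) (-z)).symm

theorem S_eval_sub_one_nonneg_and_add_one_le {z : ℝ} (hz : 2 ≤ z) {k : ℤ} (hk : 0 ≤ k) :
    0 ≤ (S ℝ (k - 1)).eval z ∧ (S ℝ (k - 1)).eval z + 1 ≤ (S ℝ k).eval z := by
  induction k, hk using Int.leInduction with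
  | base => simp
  | succ k _ ih =>
    have h := S_eval_eq (k + 1) z
    rw [add_sub_cancel_right, show k + 1 - 2 = k - 1 by ring] at h
    rw [add_sub_cancel_right]
    constructor <;> nlinarith

/-- A lower bound for the ratio of successive differences of the `S k`. -/
theorem mul_S_eval_sub_lt {z a : ℝ} (hz : 2 ≤ z) (ha : a < 1) (haz : a * z ≤ 1 + a ^ 2)
    {k : ℤ} (hk : 0 ≤ k) :
    a * ((S ℝ k).eval z - (S ℝ (k - 1)).eval z) <
      (S ℝ (k - 1)).eval z - (S ℝ (k - 2)).eval z := by
  rcases le_or_gt a 0 with ha0 | ha0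
  · have h := S_eval_sub_one_nonneg_and_add_one_le hz hk
    rcases hk.eq_or_lt with rfl | hk
    · simp; linarith
    · have h' := S_eval_sub_one_nonneg_and_add_one_le hz (show 0 ≤ k - 1 by omega)
      rw [show k - 1 - 1 = k - 2 by ring] at h'
      nlinarith
  · induction k, hk using Int.leInduction with
    | base => simpa using ha
    | succ k hk ih =>
      have h := S_eval_eq (k + 1) z
      have h' := S_eval_eq k z
      have hpos := S_eval_sub_one_nonneg_and_add_one_le hz hk
      rw [add_sub_cancel_right, show k + 1 - 2 = k - 1 by ring] at h ⊢
      nlinarith [mul_lt_mul_of_pos_left ih ha0, mul_nonneg (sub_nonneg.2 haz)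
        (show 0 ≤ (S ℝ k).eval z - (S ℝ (k - 1)).eval z by linarith)]

/-- At the smallest root of `S n - S (n - 1)`, the sign of `S n` is `-(-1) ^ n`. -/
theorem S_eval_two_mul_cos_last {n : ℤ} (hn : 1 ≤ n) :
    (S ℝ (n - 1)).eval (2 * cos ((2 * n - 1) * π / (2 * n + 1))) =
        (S ℝ n).eval (2 * cos ((2 * n - 1) * π / (2 * n + 1))) ∧
      (-1) ^ n * (S ℝ n).eval (2 * cos ((2 * n - 1) * π / (2 * n + 1))) < 0 := by
  have hn' : (1 : ℝ) ≤ n := by exact_mod_cast hn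
  set θ := (2 * n - 1) * π / (2 * n + 1) with hθ
  have hden : (2 * n + 1 : ℝ) ≠ 0 := by positivity
  have hsin : 0 < sin θ := by
    apply sin_pos_of_pos_of_lt_pi
    · have : (0 : ℝ) < 2 * n - 1 := by linarith
      positivity
    · rw [hθ, div_lt_iff₀ (by positivity)]
      nlinarith [pi_pos]
  have hsin' : 0 < sin (π / (2 * n + 1)) :=
    sin_pos_of_pos_of_lt_pi (by positivity) (div_lt_self pi_pos (by linarith))
  have h1 := S_two_mul_real_cos θ n
  have h0 := S_two_mul_real_cos θ (n - 1)
  have e1 : ((n : ℝ) + 1) * θ = n * π - π / (2 * n + 1) := by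
    rw [hθ]; field_simp; ring
  have e0 : (((n - 1 : ℤ) : ℝ) + 1) * θ = n * π - (π - π / (2 * n + 1)) := by
    push_cast
    rw [hθ]; field_simp; ring
  rw [e1, sin_sub, sin_int_mul_pi, cos_int_mul_pi] at h1
  rw [e0, sin_sub, sin_int_mul_pi, cos_int_mul_pi, sin_pi_sub] at h0
  have hsq : ((-1 : ℝ) ^ n) * (-1) ^ n = 1 := by rw [← mul_zpow]; norm_num
  refine ⟨mul_right_cancel₀ hsin.ne' (by linarith), ?_⟩
  refine neg_of_mul_neg_left (b := sin θ) ?_ hsin.le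
  rw [mul_assoc, h1]
  linear_combination (exp := 1) hsin' - sin (π / (2 * n + 1)) * hsq

end Polynomial.Chebyshev

open Polynomial.Chebyshev in
/-- The factor multiplying `S n β` in `R` at a common value of `S n β` and `S (n - 1) β`. -/
theorem riley_factor_neg {m : ℤ} (hm : 1 ≤ m) {x y : ℝ} (hx4 : x ^ 2 ≤ 4) (hy : 2 < y) :
    ((x ^ 2 - y - 1) * (S ℝ m).eval (chebAlpha x y) - (S ℝ (m - 1)).eval (chebAlpha x y)) -
      ((x ^ 2 - y - 1) * (S ℝ (m - 1)).eval (chebAlpha x y) -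
        (S ℝ (m - 2)).eval (chebAlpha x y)) < 0 := by
  have hα : chebAlpha x y = 2 + (y - 2) * (y + 2 - x ^ 2) := by rw [chebAlpha]; ring
  have hr : 0 < y + 2 - x ^ 2 := by linarith
  have h := mul_S_eval_sub_lt (z := chebAlpha x y) (a := x ^ 2 - y - 1) (k := m)
    (by rw [hα]; nlinarith [mul_pos (sub_pos.2 hy) hr]) (by linarith)
    (by
      rw [hα]
      nlinarith [mul_pos (sub_pos.2 hy) hr, mul_nonneg hr.le (sub_nonneg.2 hx4),
        mul_pos (mul_pos (sub_pos.2 hy) hr) hr])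
    (by omega)
  linarith

open Polynomial.Chebyshev in
theorem chebBeta_six_le {m : ℤ} (hm : 1 ≤ m) {x : ℝ} (hx4 : x ^ 2 ≤ 4) :
    chebBeta (fun k z => (S ℝ k).eval z) m x 6 ≤ -2 := by
  have hα : chebAlpha x 6 = 34 - 4 * x ^ 2 := by rw [chebAlpha]; ring
  obtain ⟨h0, h1⟩ := S_eval_sub_one_nonneg_and_add_one_le (z := chebAlpha x 6)
    (by rw [hα]; linarith) (show 0 ≤ m - 1 by omega)
  have h := S_eval_eq m (chebAlpha x 6)
  rw [show m - 1 - 1 = m - 2 by ring] at h0 h1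
  have hE : 1 ≤ (S ℝ m).eval (chebAlpha x 6) + (1 - 6) * (S ℝ (m - 1)).eval (chebAlpha x 6) := by
    nlinarith
  simp only [chebBeta]
  nlinarith

open Polynomial.Chebyshev in
theorem riley_six_sign {n m : ℤ} (hn : 1 ≤ n) (hm : 1 ≤ m) {x : ℝ} (hx4 : x ^ 2 ≤ 4) :
    (-1) ^ n * RileyR (fun k z => (S ℝ k).eval z) n m x 6 < 0 := by
  have hα : chebAlpha x 6 = 34 - 4 * x ^ 2 := by rw [chebAlpha]; ring
  have hα2 : 2 ≤ chebAlpha x 6 := by rw [hα]; linarith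
  obtain ⟨h0, h1⟩ := S_eval_sub_one_nonneg_and_add_one_le hα2 (show 0 ≤ m - 1 by omega)
  obtain ⟨_, h2⟩ := S_eval_sub_one_nonneg_and_add_one_le hα2 (show 0 ≤ m by omega)
  rw [show m - 1 - 1 = m - 2 by ring] at h0 h1
  have hβ := chebBeta_six_le hm hx4
  simp only [RileyR]
  set β := chebBeta (fun k z => (S ℝ k).eval z) m x 6
  obtain ⟨k0, k1⟩ := S_eval_sub_one_nonneg_and_add_one_le (z := -β)
    (by linarith) (show 0 ≤ n by omega)
  have e0 := S_eval_neg n (-β)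
  have e1 := S_eval_neg (n - 1) (-β)
  rw [neg_neg] at e0 e1
  have hsq : ((-1 : ℝ) ^ n) * (-1) ^ n = 1 := by rw [← mul_zpow]; norm_num
  rw [e0, e1, zpow_sub_one₀ (by norm_num)]
  generalize (-1 : ℝ) ^ n = σ at hsq
  have hA : (x ^ 2 - 6 - 1) * (S ℝ m).eval (chebAlpha x 6) -
      (S ℝ (m - 1)).eval (chebAlpha x 6) < 0 := by nlinarith
  have hB : (x ^ 2 - 6 - 1) * (S ℝ (m - 1)).eval (chebAlpha x 6) -
      (S ℝ (m - 2)).eval (chebAlpha x 6) < 0 := by nlinarith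
  linear_combination (exp := 1) mul_neg_of_neg_of_pos hA (show 0 < (S ℝ n).eval (-β) by linarith)
    + mul_nonpos_of_nonpos_of_nonneg hB.le k0
    + (((x ^ 2 - 6 - 1) * (S ℝ m).eval (chebAlpha x 6) - (S ℝ (m - 1)).eval (chebAlpha x 6)) *
      (S ℝ n).eval (-β) + ((x ^ 2 - 6 - 1) * (S ℝ (m - 1)).eval (chebAlpha x 6) -
      (S ℝ (m - 2)).eval (chebAlpha x 6)) * (S ℝ (n - 1)).eval (-β)) * hsq

/-- For `n ≥ 1`, `m ≥ 1` and real `x` with `4 ≥ x² > 2 + 2 cos((2n-1)π/(2n+1))`,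
the equation `R_{n,m}(x,y) = 0` has a real solution `y > 2`. -/
theorem riley_root_case1
    (S : ℤ → ℝ → ℝ)
    (hS0 : ∀ z : ℝ, S 0 z = 1)
    (hS1 : ∀ z : ℝ, S 1 z = z)
    (hSrec : ∀ (k : ℤ) (z : ℝ), S k z = z * S (k - 1) z - S (k - 2) z)
    (n m : ℤ) (hn : 1 ≤ n) (hm : 1 ≤ m) (x : ℝ)
    (hx4 : x ^ 2 ≤ 4)
    (hx : 2 + 2 * Real.cos ((2 * n - 1) * π / (2 * n + 1)) < x ^ 2) :
    ∃ y : ℝ, 2 < y ∧ RileyR S n m x y = 0 := by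
  obtain rfl := Polynomial.Chebyshev.eq_S_eval hS0 hS1 hSrec
  have hβc : Continuous (chebBeta (fun k z => (Polynomial.Chebyshev.S ℝ k).eval z) m x) := by
    unfold chebBeta chebAlpha
    fun_prop
  have hRc : Continuous (RileyR (fun k z => (Polynomial.Chebyshev.S ℝ k).eval z) n m x) := by
    unfold RileyR chebAlpha
    fun_prop
  have hβ2 : chebBeta (fun k z => (Polynomial.Chebyshev.S ℝ k).eval z) m x 2 = x ^ 2 - 2 := by
    have hα : chebAlpha x 2 = 2 := by rw [chebAlpha]; ring
    simp only [chebBeta, hα, Polynomial.Chebyshev.S_eval_two]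
    push_cast
    ring
  have hcos := Real.neg_one_le_cos ((2 * n - 1) * π / (2 * n + 1))
  obtain ⟨y₀, ⟨hy₀, hy₀6⟩, hβ⟩ := intermediate_value_Icc' (show (2 : ℝ) ≤ 6 by norm_num)
    hβc.continuousOn (show 2 * cos ((2 * n - 1) * π / (2 * n + 1)) ∈ _ from
      ⟨(chebBeta_six_le hm hx4).trans (by linarith), by linarith⟩)
  replace hy₀ : 2 < y₀ := hy₀.lt_of_ne fun h => by
    rw [← h, hβ2] at hβ
    linarith
  have hpos : 0 < (-1) ^ n * RileyR (fun k z => (Polynomial.Chebyshev.S ℝ k).eval z) n m x y₀ := by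
    obtain ⟨heq, hneg⟩ := Polynomial.Chebyshev.S_eval_two_mul_cos_last hn
    simp only [RileyR, hβ, heq]
    linear_combination (exp := 1) mul_pos_of_neg_of_neg hneg (riley_factor_neg hm hx4 hy₀)
  obtain ⟨y, ⟨hy, -⟩, hR⟩ := intermediate_value_Icc' hy₀6
    (continuous_const.mul hRc).continuousOn ⟨(riley_six_sign hn hm hx4).le, hpos.le⟩
  exact ⟨y, hy₀.trans_le hy, (mul_eq_zero.1 hR).resolve_left (by positivity)⟩
end

section
/- Let m be an integer and r a positive integer. The equation R_{1,m}(2cos(π/r), y) = 0 has at least one real solution y > 2 in the following cases: (1) r = 5 or r = 6 when m = 1 or m = 2; (2) r = 6 when m ≥ 3. -/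
open Real

/-- Continuity of the Chebyshev polynomials of index at least `-1`. -/
theorem cheb_continuous {S : ℤ → ℝ → ℝ} (hS0 : ∀ z : ℝ, S 0 z = 1) (hS1 : ∀ z : ℝ, S 1 z = z)
    (hSrec : ∀ (k : ℤ) (z : ℝ), S k z = z * S (k - 1) z - S (k - 2) z) (n : ℕ) :
    Continuous (S (n - 1)) ∧ Continuous (S n) := by
  induction n with
  | zero =>
    have h_neg (z : ℝ) : S (-1) z = 0 := by
      have h := hSrec 1 z
      norm_num [hS0, hS1] at h
      linarith
    constructor
    · simpa [funext h_neg] using continuous_const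
    · simpa [funext hS0] using continuous_const
  | succ n ih =>
    have h_eq : S ((n : ℤ) + 1) = fun z => z * S n z - S (n - 1) z := by
      funext z
      rw [hSrec, add_sub_cancel_right, show (n : ℤ) + 1 - 2 = n - 1 by ring]
    push_cast
    rw [add_sub_cancel_right, h_eq]
    exact ⟨ih.2, (continuous_id.mul ih.2).sub ih.1⟩

/-- `S_k(2) = k + 1`. -/
theorem cheb_two {S : ℤ → ℝ → ℝ} (hS0 : ∀ z : ℝ, S 0 z = 1) (hS1 : ∀ z : ℝ, S 1 z = z)
    (hSrec : ∀ (k : ℤ) (z : ℝ), S k z = z * S (k - 1) z - S (k - 2) z) (n : ℕ) :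
    S (n - 1) 2 = n ∧ S n 2 = n + 1 := by
  induction n with
  | zero =>
    have h := hSrec 1 2
    norm_num [hS0, hS1] at h ⊢
    linarith
  | succ n ih =>
    have h := hSrec (n + 1) 2
    rw [add_sub_cancel_right, show (n : ℤ) + 1 - 2 = n - 1 by ring, ih.1, ih.2] at h
    push_cast
    rw [add_sub_cancel_right]
    exact ⟨ih.2, by linarith⟩

/-- Growth of the Chebyshev polynomials at a point `z ≥ 4`. -/
theorem cheb_growth {S : ℤ → ℝ → ℝ} (hS0 : ∀ z : ℝ, S 0 z = 1) (hS1 : ∀ z : ℝ, S 1 z = z)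
    (hSrec : ∀ (k : ℤ) (z : ℝ), S k z = z * S (k - 1) z - S (k - 2) z) {z : ℝ} (hz : 4 ≤ z)
    (n : ℕ) : 0 ≤ S (n - 1) z ∧ 1 ≤ S n z ∧ 2 * S n z + 2 ≤ S (n + 1) z := by
  induction n with
  | zero =>
    have h := hSrec 1 z
    norm_num [hS0, hS1] at h ⊢
    exact ⟨by linarith, hz⟩
  | succ n ih =>
    obtain ⟨-, h1, h2⟩ := ih
    have h := hSrec (n + 1 + 1) z
    rw [add_sub_cancel_right, show (n : ℤ) + 1 + 1 - 2 = n by ring] at h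
    push_cast
    rw [add_sub_cancel_right]
    exact ⟨by linarith, by linarith, by nlinarith⟩

/-- `R_{1,m}(x, ·)` is positive at `y = 3` when `x² ≤ 3` and `m ≥ 1`, so it has a root `y > 2`
as soon as its value at `y = 2` is negative. -/
theorem exists_riley_root {S : ℤ → ℝ → ℝ} (hS0 : ∀ z : ℝ, S 0 z = 1) (hS1 : ∀ z : ℝ, S 1 z = z)
    (hSrec : ∀ (k : ℤ) (z : ℝ), S k z = z * S (k - 1) z - S (k - 2) z) {m : ℤ} (hm : 1 ≤ m)
    {x : ℝ} (hx : x ^ 2 ≤ 3)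
    (hneg : m * ((x ^ 2 - 3) * (x ^ 2 - 4)) + (x ^ 2) ^ 2 - 5 * x ^ 2 + 5 < 0) :
    ∃ y : ℝ, 2 < y ∧ RileyR S 1 m x y = 0 := by
  obtain ⟨n, rfl⟩ : ∃ n : ℕ, m = n + 1 := ⟨(m - 1).toNat, by omega⟩
  have h_sub : (n : ℤ) + 1 - 2 = n - 1 := by ring
  have h_cont : Continuous (RileyR S 1 ((n : ℤ) + 1) x) := by
    have h_low := cheb_continuous hS0 hS1 hSrec n
    have h_top := (cheb_continuous hS0 hS1 hSrec (n + 1)).2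
    push_cast at h_top
    have h1 := h_low.1
    have h2 := h_low.2
    unfold RileyR chebBeta chebAlpha
    simp only [hS0, hS1, sub_self, add_sub_cancel_right, h_sub]
    fun_prop
  have h_two : RileyR S 1 ((n : ℤ) + 1) x 2 < 0 := by
    have h_low := cheb_two hS0 hS1 hSrec n
    have h_top := (cheb_two hS0 hS1 hSrec (n + 1)).2
    push_cast at h_top
    have h_alpha : chebAlpha x 2 = 2 := by unfold chebAlpha; ring
    unfold RileyR chebBeta
    simp only [hS0, hS1, sub_self, add_sub_cancel_right, h_sub, h_alpha, h_low.1, h_low.2, h_top]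
    push_cast at hneg
    convert hneg using 1
    ring
  have h_three : 0 < RileyR S 1 ((n : ℤ) + 1) x 3 := by
    have h_alpha : 4 ≤ chebAlpha x 3 := by unfold chebAlpha; linarith
    obtain ⟨h0, h1, h2⟩ := cheb_growth hS0 hS1 hSrec h_alpha n
    unfold RileyR chebBeta
    simp only [hS0, hS1, sub_self, add_sub_cancel_right, h_sub]
    generalize chebAlpha x 3 = a at *
    generalize S ((n : ℤ) + 1) a = u at *
    generalize S (n : ℤ) a = v at *
    generalize S ((n : ℤ) - 1) a = w at *
    have h_sq : 4 ≤ (u + (1 - 3) * v) ^ 2 := by nlinarith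
    have h_beta : 2 + (x ^ 2 - 3 - 2) * (u + (1 - 3) * v) ^ 2 < 0 := by nlinarith
    have h_coeff : (x ^ 2 - 3 - 1) * u - v < 0 := by nlinarith
    have h_rest : (x ^ 2 - 3 - 1) * v - w < 0 := by nlinarith
    have h_prod := mul_pos_of_neg_of_neg h_coeff h_beta
    linarith
  obtain ⟨y, hy, hy0⟩ := intermediate_value_Ioo (by norm_num : (2 : ℝ) ≤ 3)
    h_cont.continuousOn ⟨h_two, h_three⟩
  exact ⟨y, hy.1, hy0⟩

/-- The case `r = 6`, for all `m ≥ 1`. -/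
theorem exists_riley_root_six {S : ℤ → ℝ → ℝ} (hS0 : ∀ z : ℝ, S 0 z = 1)
    (hS1 : ∀ z : ℝ, S 1 z = z)
    (hSrec : ∀ (k : ℤ) (z : ℝ), S k z = z * S (k - 1) z - S (k - 2) z) {m : ℤ} (hm : 1 ≤ m) :
    ∃ y : ℝ, 2 < y ∧ RileyR S 1 m (2 * Real.cos (π / 6)) y = 0 := by
  have hx : (2 * Real.cos (π / 6)) ^ 2 = 3 := by
    rw [Real.cos_pi_div_six, mul_div_cancel₀ _ (two_ne_zero), Real.sq_sqrt (by norm_num)]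
  refine exists_riley_root hS0 hS1 hSrec hm hx.le ?_
  rw [hx]
  norm_num

/-- The case `r = 5`, for `m = 1` and `m = 2`. -/
theorem exists_riley_root_five {S : ℤ → ℝ → ℝ} (hS0 : ∀ z : ℝ, S 0 z = 1)
    (hS1 : ∀ z : ℝ, S 1 z = z)
    (hSrec : ∀ (k : ℤ) (z : ℝ), S k z = z * S (k - 1) z - S (k - 2) z) {m : ℤ}
    (hm : m = 1 ∨ m = 2) :
    ∃ y : ℝ, 2 < y ∧ RileyR S 1 m (2 * Real.cos (π / 5)) y = 0 := by
  have h5 : √(5 : ℝ) ^ 2 = 5 := Real.sq_sqrt (by norm_num)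
  have h_lower : 2.2 < √(5 : ℝ) := Real.lt_sqrt_of_sq_lt (by norm_num)
  have h_upper : √(5 : ℝ) < 2.25 := (Real.sqrt_lt' (by norm_num)).2 (by norm_num)
  have hx : (2 * Real.cos (π / 5)) ^ 2 = (3 + √5) / 2 := by
    rw [Real.cos_pi_div_five]
    linear_combination h5 / 4
  refine exists_riley_root hS0 hS1 hSrec (by omega) (by linarith) ?_
  rw [hx]
  rcases hm with rfl | rfl <;> norm_num <;> nlinarith

/-- `R_{1,m}(2 cos(π/r), y) = 0` has a real solution `y > 2` when
(1) `r = 5` or `r = 6` and `m = 1` or `m = 2`; (2) `r = 6` and `m ≥ 3`. -/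
theorem riley_root_n_one_pos_m
    (S : ℤ → ℝ → ℝ)
    (hS0 : ∀ z : ℝ, S 0 z = 1)
    (hS1 : ∀ z : ℝ, S 1 z = z)
    (hSrec : ∀ (k : ℤ) (z : ℝ), S k z = z * S (k - 1) z - S (k - 2) z)
    (m : ℤ) (r : ℕ) (hr : 1 ≤ r) :
    ((r = 5 ∨ r = 6) → (m = 1 ∨ m = 2) →
      ∃ y : ℝ, 2 < y ∧ RileyR S 1 m (2 * Real.cos (π / r)) y = 0) ∧
    (r = 6 → 3 ≤ m →
      ∃ y : ℝ, 2 < y ∧ RileyR S 1 m (2 * Real.cos (π / r)) y = 0) := by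
  constructor
  · rintro (rfl | rfl) hm
    · exact_mod_cast exists_riley_root_five hS0 hS1 hSrec hm
    · exact_mod_cast exists_riley_root_six hS0 hS1 hSrec (by omega)
  · rintro rfl hm
    exact_mod_cast exists_riley_root_six hS0 hS1 hSrec (by omega)
end

section
/- Let m ≤ -1 be an integer and r a positive integer. The equation R_{n,m}(2cos(π/r), y) = 0 has at least one real solution y > 2 in the following cases: (1) r = 3 when n = 4 or n = 5; (2) r = 3 or r = 4 when n = 3; (3) 4 ≤ r ≤ 10 when n = 2. -/
open Real

/-- The value at `z` of the Chebyshev polynomial `Polynomial.Chebyshev.S ℝ k`. -/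
noncomputable def chebyshevS (k : ℤ) (z : ℝ) : ℝ := (Polynomial.Chebyshev.S ℝ k).eval z

@[fun_prop]
theorem continuous_chebyshevS (k : ℤ) : Continuous (chebyshevS k) :=
  (Polynomial.Chebyshev.S ℝ k).continuous

@[simp]
theorem chebyshevS_zero (z : ℝ) : chebyshevS 0 z = 1 := by simp [chebyshevS]

@[simp]
theorem chebyshevS_one (z : ℝ) : chebyshevS 1 z = z := by simp [chebyshevS]

@[simp]
theorem chebyshevS_neg_one (z : ℝ) : chebyshevS (-1) z = 0 := by simp [chebyshevS]

theorem chebyshevS_add_one (k : ℤ) (z : ℝ) :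
    chebyshevS (k + 1) z = z * chebyshevS k z - chebyshevS (k - 1) z := by
  simp [chebyshevS, Polynomial.Chebyshev.S_add_one]

theorem chebyshevS_neg_sub_two (k : ℤ) (z : ℝ) : chebyshevS (-k - 2) z = -chebyshevS k z := by
  simp [chebyshevS, Polynomial.Chebyshev.S_neg_sub_two]

/-- A family satisfying the Chebyshev recursion is `chebyshevS`. -/
theorem eq_chebyshevS {S : ℤ → ℝ → ℝ} (hS0 : ∀ z : ℝ, S 0 z = 1) (hS1 : ∀ z : ℝ, S 1 z = z)
    (hSrec : ∀ (k : ℤ) (z : ℝ), S k z = z * S (k - 1) z - S (k - 2) z) :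
    S = chebyshevS := by
  funext k z
  induction k using Polynomial.Chebyshev.induct with
  | zero => simp [hS0]
  | one => simp [hS1]
  | add_two n h1 h0 =>
    rw [hSrec, show (n + 2 : ℤ) = n + 1 + 1 by ring, chebyshevS_add_one,
      show (n + 1 + 1 - 2 : ℤ) = n by ring, add_sub_cancel_right, add_sub_cancel_right, h1, h0]
  | neg_add_one n h0 h1 =>
    have h := hSrec (-n + 1) z
    rw [add_sub_cancel_right, show (-n + 1 - 2 : ℤ) = -n - 1 by ring, h0, h1,
      chebyshevS_add_one] at h
    linarith

theorem chebyshevS_nonneg_and_add_one_le {z : ℝ} (hz : 2 ≤ z) (j : ℕ) :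
    0 ≤ chebyshevS (j - 1) z ∧
      chebyshevS (j - 1) z + 1 ≤ chebyshevS j z := by
  induction j with
  | zero => simp
  | succ j ih =>
    obtain ⟨h0, h1⟩ := ih
    push_cast
    rw [add_sub_cancel_right, chebyshevS_add_one]
    exact ⟨by linarith, by nlinarith⟩

theorem two_le_chebAlpha {x y : ℝ} (hx : x ^ 2 ≤ 4) (hy : 2 ≤ y) : 2 ≤ chebAlpha x y := by
  unfold chebAlpha
  nlinarith [mul_nonneg (sub_nonneg.2 hy) (by linarith : 0 ≤ y + 2 - x ^ 2)]

/-- For `m ≤ -1` and `z ≥ 2` the values `-S_m(z)`, `-S_{m-1}(z)`, `-S_{m-2}(z)` are nonnegative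
and increase by at least one at each step. -/
theorem chebyshevS_of_le_neg_one {m : ℤ} (hm : m ≤ -1) {z : ℝ} (hz : 2 ≤ z) :
    chebyshevS m z ≤ 0 ∧ chebyshevS (m - 1) z + 1 ≤ chebyshevS m z ∧
      chebyshevS (m - 2) z + 1 ≤ chebyshevS (m - 1) z := by
  obtain ⟨j, rfl⟩ : ∃ j : ℕ, m = -j - 1 := ⟨(-m - 1).toNat, by omega⟩
  have e0 : (-j - 1 : ℤ) = -(j - 1) - 2 := by ring
  have e1 : (-j - 1 - 1 : ℤ) = -j - 2 := by ring
  have e2 : (-j - 1 - 2 : ℤ) = -(j + 1) - 2 := by ring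
  rw [e1, e2, e0, chebyshevS_neg_sub_two, chebyshevS_neg_sub_two, chebyshevS_neg_sub_two]
  obtain ⟨h0, h1⟩ := chebyshevS_nonneg_and_add_one_le hz j
  have h2 := (chebyshevS_nonneg_and_add_one_le hz (j + 1)).2
  push_cast at h2
  rw [add_sub_cancel_right] at h2
  exact ⟨by linarith, by linarith, by linarith⟩

theorem continuous_chebBeta (m : ℤ) (x : ℝ) : Continuous (chebBeta chebyshevS m x) := by
  unfold chebBeta chebAlpha
  fun_prop

theorem continuous_RileyR (n m : ℤ) (x : ℝ) : Continuous (RileyR chebyshevS n m x) := by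
  have h := continuous_chebBeta m x
  unfold RileyR
  simp only [chebAlpha]
  fun_prop

theorem chebBeta_two (m : ℤ) (x : ℝ) : chebBeta chebyshevS m x 2 = x ^ 2 - 2 := by
  have hα : chebAlpha x 2 = 2 := by unfold chebAlpha; ring
  simp only [chebBeta, hα, chebyshevS, Polynomial.Chebyshev.S_eval_two]
  push_cast
  ring

theorem chebBeta_le {m : ℤ} (hm : m ≤ -1) {x y : ℝ} (hx : x ^ 2 ≤ 4) (hy : 2 ≤ y) :
    chebBeta chebyshevS m x y ≤ x ^ 2 - y := by
  obtain ⟨h0, h1, -⟩ := chebyshevS_of_le_neg_one hm (two_le_chebAlpha hx hy)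
  unfold chebBeta
  set p := chebyshevS m (chebAlpha x y)
  set q := chebyshevS (m - 1) (chebAlpha x y)
  have hP : 1 ≤ p + (1 - y) * q := by nlinarith
  have hP2 : 1 ≤ (p + (1 - y) * q) ^ 2 := one_le_pow₀ hP
  nlinarith

/-- If `b₂ < b₁ ≤ x² - 2` with `S_{n-1}(b₁) = 0` and `S_n(b₂) = 0`, and if `S_n(b₁)` and
`S_{n-1}(b₂)` have the same sign, then `R_{n,m}(x, y)` vanishes for some `y > 2`. -/
theorem exists_RileyR_eq_zero {n m : ℤ} (hm : m ≤ -1) {x b₁ b₂ : ℝ} (hx : x ^ 2 ≤ 4)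
    (hb₁ : b₁ ≤ x ^ 2 - 2) (hb : b₂ < b₁)
    (h₁ : chebyshevS (n - 1) b₁ = 0) (h₂ : chebyshevS n b₂ = 0)
    (hpos : 0 < chebyshevS n b₁ * chebyshevS (n - 1) b₂) :
    ∃ y : ℝ, 2 < y ∧ RileyR chebyshevS n m x y = 0 := by
  have hβ := continuous_chebBeta m x
  obtain ⟨y₂, ⟨hy₂, -⟩, hβ₂⟩ : b₂ ∈ chebBeta chebyshevS m x '' Set.Icc 2 (x ^ 2 - b₂) :=
    intermediate_value_Icc' (by linarith) hβ.continuousOn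
      ⟨by linarith [chebBeta_le hm hx (by linarith : 2 ≤ x ^ 2 - b₂)],
        by rw [chebBeta_two]; linarith⟩
  obtain ⟨y₁, ⟨hy₁, hy₁₂⟩, hβ₁⟩ : b₁ ∈ chebBeta chebyshevS m x '' Set.Icc 2 y₂ :=
    intermediate_value_Icc' hy₂ hβ.continuousOn
      ⟨by rw [hβ₂]; exact hb.le, by rw [chebBeta_two]; exact hb₁⟩
  obtain ⟨p0, p1, -⟩ := chebyshevS_of_le_neg_one hm (two_le_chebAlpha hx hy₁)
  obtain ⟨q0, q1, q2⟩ := chebyshevS_of_le_neg_one hm (two_le_chebAlpha hx hy₂)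
  have hR₁ : ∃ A > 0, RileyR chebyshevS n m x y₁ = A * chebyshevS n b₁ := by
    refine ⟨_, ?_, by rw [RileyR, hβ₁, h₁, mul_zero, sub_zero]⟩
    nlinarith
  have hR₂ : ∃ B > 0, RileyR chebyshevS n m x y₂ = -(B * chebyshevS (n - 1) b₂) := by
    refine ⟨_, ?_, by rw [RileyR, hβ₂, h₂, mul_zero, zero_sub]⟩
    nlinarith
  obtain ⟨A, hA, hR₁⟩ := hR₁
  obtain ⟨B, hB, hR₂⟩ := hR₂
  have hR := (continuous_RileyR n m x).continuousOn (s := Set.Icc y₁ y₂)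
  have hroot : (0 : ℝ) ∈ RileyR chebyshevS n m x '' Set.Icc y₁ y₂ := by
    rcases pos_and_pos_or_neg_and_neg_of_mul_pos hpos with ⟨ha, hb⟩ | ⟨ha, hb⟩
    · refine intermediate_value_Icc' hy₁₂ hR ⟨?_, ?_⟩
      · rw [hR₂]; exact neg_nonpos.2 (mul_pos hB hb).le
      · rw [hR₁]; exact (mul_pos hA ha).le
    · refine intermediate_value_Icc hy₁₂ hR ⟨?_, ?_⟩
      · rw [hR₁]; exact (mul_neg_of_pos_of_neg hA ha).le
      · rw [hR₂]; exact neg_nonneg.2 (mul_neg_of_pos_of_neg hB hb).le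
  obtain ⟨y, ⟨hy, -⟩, hy0⟩ := hroot
  refine ⟨y, lt_of_le_of_ne (hy₁.trans hy) ?_, hy0⟩
  rintro rfl
  obtain rfl : y₁ = 2 := le_antisymm hy hy₁
  exact mul_ne_zero hA.ne' (left_ne_zero_of_mul hpos.ne') (hR₁.symm.trans hy0)

theorem chebyshevS_two (z : ℝ) : chebyshevS 2 z = z ^ 2 - 1 := by
  simp [chebyshevS, Polynomial.Chebyshev.S_two]

theorem chebyshevS_three (z : ℝ) : chebyshevS 3 z = z ^ 3 - 2 * z := by
  have h := chebyshevS_add_one 2 z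
  norm_num [chebyshevS_two] at h
  linear_combination h

theorem chebyshevS_four (z : ℝ) : chebyshevS 4 z = z ^ 4 - 3 * z ^ 2 + 1 := by
  have h := chebyshevS_add_one 3 z
  norm_num [chebyshevS_two, chebyshevS_three] at h
  linear_combination h

theorem chebyshevS_five (z : ℝ) : chebyshevS 5 z = z ^ 5 - 4 * z ^ 3 + 3 * z := by
  have h := chebyshevS_add_one 4 z
  norm_num [chebyshevS_three, chebyshevS_four] at h
  linear_combination h

theorem two_mul_cos_sq_le_four (t : ℝ) : (2 * cos t) ^ 2 ≤ 4 := by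
  nlinarith [cos_sq_le_one t]

theorem one_le_two_mul_cos_pi_div_sq {r : ℕ} (hr : 3 ≤ r) : 1 ≤ (2 * cos (π / r)) ^ 2 := by
  have h : (3 : ℝ) ≤ r := by exact_mod_cast hr
  have hcos : cos (π / 3) ≤ cos (π / r) :=
    cos_le_cos_of_nonneg_of_le_pi (by positivity) (by linarith [pi_pos])
      (div_le_div_of_nonneg_left pi_pos.le (by norm_num) h)
  rw [cos_pi_div_three] at hcos
  nlinarith

theorem two_le_two_mul_cos_pi_div_sq {r : ℕ} (hr : 4 ≤ r) : 2 ≤ (2 * cos (π / r)) ^ 2 := by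
  have h : (4 : ℝ) ≤ r := by exact_mod_cast hr
  have hcos : cos (π / 4) ≤ cos (π / r) :=
    cos_le_cos_of_nonneg_of_le_pi (by positivity) (by linarith [pi_pos])
      (div_le_div_of_nonneg_left pi_pos.le (by norm_num) h)
  rw [cos_pi_div_four] at hcos
  have h2 : √2 ≤ 2 * cos (π / r) := by linarith
  calc (2 : ℝ) = √2 ^ 2 := (sq_sqrt zero_le_two).symm
    _ ≤ _ := by gcongr

/-- For `m ≤ -1`, the equation `R_{n,m}(2 cos(π/r), y) = 0` has a real solution
`y > 2` when (1) `r = 3` and `n = 4` or `n = 5`; (2) `r = 3` or `r = 4` and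
`n = 3`; (3) `4 ≤ r ≤ 10` and `n = 2`. -/
theorem riley_root_case2_small
    (S : ℤ → ℝ → ℝ)
    (hS0 : ∀ z : ℝ, S 0 z = 1)
    (hS1 : ∀ z : ℝ, S 1 z = z)
    (hSrec : ∀ (k : ℤ) (z : ℝ), S k z = z * S (k - 1) z - S (k - 2) z)
    (n m : ℤ) (hm : m ≤ -1) (r : ℕ) (hr : 1 ≤ r) :
    (r = 3 → (n = 4 ∨ n = 5) →
      ∃ y : ℝ, 2 < y ∧ RileyR S n m (2 * Real.cos (π / r)) y = 0) ∧
    ((r = 3 ∨ r = 4) → n = 3 →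
      ∃ y : ℝ, 2 < y ∧ RileyR S n m (2 * Real.cos (π / r)) y = 0) ∧
    (4 ≤ r → r ≤ 10 → n = 2 →
      ∃ y : ℝ, 2 < y ∧ RileyR S n m (2 * Real.cos (π / r)) y = 0) := by
  obtain rfl := eq_chebyshevS hS0 hS1 hSrec
  have h2 : √2 ^ 2 = 2 := sq_sqrt zero_le_two
  have h3 : √3 ^ 2 = 3 := sq_sqrt zero_le_three
  have hg := goldenRatio_sq
  have hg1 := one_lt_goldenRatio
  have hs1 : 1 < √2 := by nlinarith [sqrt_nonneg 2]
  have hs2 : √2 < goldenRatio := by nlinarith [sqrt_nonneg 2]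
  have hs3 : goldenRatio < √3 := by nlinarith [sqrt_nonneg 3, goldenRatio_lt_two]
  have hx := two_mul_cos_sq_le_four (π / r)
  refine ⟨?_, ?_, ?_⟩
  · rintro hr3 (rfl | rfl) <;> have hx1 := one_le_two_mul_cos_pi_div_sq hr3.ge
    · have e1 : chebyshevS (4 - 1) (-√2) = 0 := by
        norm_num only [chebyshevS_three]
        linear_combination (-√2) * h2
      have e2 : chebyshevS 4 (-√2) = -1 := by
        rw [chebyshevS_four]
        linear_combination (√2 ^ 2 - 1) * h2
      have e3 : chebyshevS 4 (-goldenRatio) = 0 := by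
        rw [chebyshevS_four]
        linear_combination (goldenRatio ^ 2 + goldenRatio - 1) * hg
      have e4 : chebyshevS (4 - 1) (-goldenRatio) = -1 := by
        norm_num only [chebyshevS_three]
        linear_combination (-goldenRatio - 1) * hg
      exact exists_RileyR_eq_zero hm hx (by linarith) (neg_lt_neg hs2) e1 e3
        (by rw [e2, e4]; norm_num)
    · have e1 : chebyshevS (5 - 1) (-goldenRatio) = 0 := by
        norm_num only [chebyshevS_four]
        linear_combination (goldenRatio ^ 2 + goldenRatio - 1) * hg
      have e2 : chebyshevS 5 (-goldenRatio) = 1 := by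
        rw [chebyshevS_five]
        linear_combination (-goldenRatio ^ 3 - goldenRatio ^ 2 + 2 * goldenRatio + 1) * hg
      have e3 : chebyshevS 5 (-√3) = 0 := by
        rw [chebyshevS_five]
        linear_combination (-√3 ^ 3 + √3) * h3
      have e4 : chebyshevS (5 - 1) (-√3) = 1 := by
        norm_num only [chebyshevS_four]
        linear_combination √3 ^ 2 * h3
      exact exists_RileyR_eq_zero hm hx (by nlinarith) (neg_lt_neg hs3) e1 e3
        (by rw [e2, e4]; norm_num)
  · rintro hr34 rfl
    have hx1 := one_le_two_mul_cos_pi_div_sq (r := r) (by omega)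
    have e1 : chebyshevS (3 - 1) (-1) = 0 := by norm_num [chebyshevS_two]
    have e2 : chebyshevS 3 (-1) = 1 := by rw [chebyshevS_three]; norm_num
    have e3 : chebyshevS 3 (-√2) = 0 := by
      rw [chebyshevS_three]
      linear_combination (-√2) * h2
    have e4 : chebyshevS (3 - 1) (-√2) = 1 := by
      norm_num only [chebyshevS_two]
      linear_combination h2
    exact exists_RileyR_eq_zero hm hx (by linarith) (neg_lt_neg hs1) e1 e3
      (by rw [e2, e4]; norm_num)
  · rintro hr4 - rfl
    have hx2 := two_le_two_mul_cos_pi_div_sq hr4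
    have e1 : chebyshevS (2 - 1) 0 = 0 := by norm_num
    have e2 : chebyshevS 2 0 = -1 := by rw [chebyshevS_two]; norm_num
    have e3 : chebyshevS 2 (-1) = 0 := by rw [chebyshevS_two]; norm_num
    have e4 : chebyshevS (2 - 1) (-1) = -1 := by norm_num
    exact exists_RileyR_eq_zero hm hx (by linarith) (by norm_num) e1 e3
      (by rw [e2, e4]; norm_num)
end

section
/- Let m ≥ 1 be an integer and let x be a real number with 4 ≥ x^2 > 2 + 2m/(m+1). Then there exists a unique real number y₀ > 2 such that S_m(α₀) + (1 - y₀)·S_{m-1}(α₀) = 1, where α₀ = y₀^2 - x^2·y₀ + 2x^2 - 2. -/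
open Real

open Polynomial in
theorem chebyshevS_eval_unique (S : ℤ → ℝ → ℝ)
    (hS0 : ∀ z : ℝ, S 0 z = 1)
    (hS1 : ∀ z : ℝ, S 1 z = z)
    (hSrec : ∀ (k : ℤ) (z : ℝ), S k z = z * S (k - 1) z - S (k - 2) z) (n : ℕ) (z : ℝ) :
    S n z = (Chebyshev.S ℝ n).eval z := by
  induction n using Nat.twoStepInduction with
  | zero => simp [hS0]
  | one => simp [hS1]
  | more n ih ih' =>
    rw [hSrec, Chebyshev.S_eq]
    push_cast at ih' ⊢
    rw [show (n : ℤ) + 2 - 1 = n + 1 by ring, show (n : ℤ) + 2 - 2 = n by ring, ih, ih']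
    simp

open Polynomial in
/-- On `[2, ∞)` the values of consecutive Chebyshev polynomials, and their differences, are
positive and increasing. -/
theorem chebyshevS_eval_mono (n : ℕ) {z w : ℝ} (hz : 2 ≤ z) (hzw : z ≤ w) :
    (1 ≤ (Chebyshev.S ℝ n).eval z ∧ (Chebyshev.S ℝ n).eval z ≤ (Chebyshev.S ℝ n).eval w) ∧
      1 + (z - 2) ≤ (Chebyshev.S ℝ (n + 1)).eval z - (Chebyshev.S ℝ n).eval z ∧
      (Chebyshev.S ℝ (n + 1)).eval z - (Chebyshev.S ℝ n).eval z ≤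
        (Chebyshev.S ℝ (n + 1)).eval w - (Chebyshev.S ℝ n).eval w := by
  induction n with
  | zero => norm_num [hzw]; linarith
  | succ n ih =>
    obtain ⟨⟨h1, h2⟩, h3, h4⟩ := ih
    push_cast
    rw [show (n : ℤ) + 1 + 1 = n + 2 by ring, Chebyshev.S_add_two]
    simp only [eval_sub, eval_mul, eval_X]
    have h5 : 1 ≤ (Chebyshev.S ℝ (n + 1)).eval z := by linarith
    have h6 : (Chebyshev.S ℝ (n + 1)).eval z ≤ (Chebyshev.S ℝ (n + 1)).eval w := by linarith
    have h7 : (z - 2) * (Chebyshev.S ℝ (n + 1)).eval z ≤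
        (w - 2) * (Chebyshev.S ℝ (n + 1)).eval w := by
      gcongr; linarith
    have h8 : 0 ≤ (z - 2) * (Chebyshev.S ℝ (n + 1)).eval z :=
      mul_nonneg (by linarith) (by linarith)
    exact ⟨⟨h5, h6⟩, by linarith, by linarith⟩

/-- If `a² - (s + 2) a b + b² = 1` with `s = t (t + d)`, then `a + (1 - y) b = 1` for `y = t + 2`
amounts to the equation `(s + d) (a + b) = 4 - d`. -/
theorem add_mul_eq_one_iff {a b t d : ℝ} (ht : 0 < t) (hd : 0 ≤ d) (hb : 0 < b) (hab : b + 1 < a)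
    (h : a ^ 2 - (t * (t + d) + 2) * a * b + b ^ 2 = 1) :
    a + (1 - (t + 2)) * b = 1 ↔ (t * (t + d) + d) * (a + b) = 4 - d := by
  have key : a * ((a + (1 - (t + 2)) * b - 1) * ((a - b - 1 + (t + d) * b) * (a + b + 1))) =
      a * (((t * (t + d) + d) * (a + b) - (4 - d)) * ((a - b - 1) * b)) := by
    linear_combination ((a - 1) * (a + b + 1) - (a - b - 1)) * h
  have ha : 0 < a := by linarith
  replace key := mul_left_cancel₀ ha.ne' key
  have h1 : (a - b - 1 + (t + d) * b) * (a + b + 1) ≠ 0 := by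
    have : 0 < a - b - 1 := by linarith
    positivity
  have h2 : (a - b - 1) * b ≠ 0 := (mul_pos (by linarith) hb).ne'
  rw [← sub_eq_zero, ← sub_eq_zero (b := 4 - d)]
  constructor <;> intro h0
  · simpa [h0, h2] using key.symm
  · rw [h0, zero_mul] at key
    exact (mul_eq_zero.mp key).resolve_right h1

open Polynomial in
theorem existsUnique_chebyshevS_eval (n : ℕ) {d : ℝ} (hd : 0 ≤ d) (hd' : d * (n + 2) < 2) :
    ∃! t : ℝ, 0 < t ∧ (t * (t + d) + d) * ((Chebyshev.S ℝ (n + 1)).eval (t * (t + d) + 2) +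
      (Chebyshev.S ℝ n).eval (t * (t + d) + 2)) = 4 - d := by
  set K : ℝ → ℝ := fun t ↦ (t * (t + d) + d) *
    ((Chebyshev.S ℝ (n + 1)).eval (t * (t + d) + 2) +
      (Chebyshev.S ℝ n).eval (t * (t + d) + 2)) with hK
  have hmono : StrictMonoOn K (Set.Ici 0) := by
    intro t ht u hu htu
    rw [Set.mem_Ici] at ht hu
    have hlt : t * (t + d) < u * (u + d) := by nlinarith
    have h0 : 0 ≤ t * (t + d) := by positivity
    obtain ⟨⟨h1, h2⟩, h3, h4⟩ := chebyshevS_eval_mono n (z := t * (t + d) + 2)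
      (w := u * (u + d) + 2) (by linarith) (by linarith)
    exact mul_lt_mul (by linarith) (by linarith) (by linarith) (by linarith)
  have hcont : Continuous K := by fun_prop
  have hK0 : K 0 < 4 - d := by
    have h := Chebyshev.S_eval_two ℝ n
    have h' := Chebyshev.S_eval_two ℝ (n + 1)
    push_cast at h h'
    simp only [hK, zero_mul, zero_add, h, h']
    linarith
  have hK2 : 4 - d < K 2 := by
    obtain ⟨⟨h1, -⟩, h3, -⟩ := chebyshevS_eval_mono n (z := 2 * (2 + d) + 2) (by linarith) le_rfl
    simp only [hK]
    nlinarith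
  obtain ⟨t, ht, hKt⟩ := intermediate_value_Ioo zero_le_two hcont.continuousOn ⟨hK0, hK2⟩
  refine ⟨t, ⟨ht.1, hKt⟩, fun u hu ↦ hmono.injOn hu.1.le ht.1.le (hu.2.trans hKt.symm)⟩

/-- For `m ≥ 1` and real `x` with `4 ≥ x² > 2 + 2m/(m+1)`, there is a unique
`y₀ > 2` with `S_m(α₀) + (1 - y₀) S_{m-1}(α₀) = 1`, where
`α₀ = y₀² - x² y₀ + 2x² - 2`. -/
theorem unique_y_eq_one
    (S : ℤ → ℝ → ℝ)
    (hS0 : ∀ z : ℝ, S 0 z = 1)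
    (hS1 : ∀ z : ℝ, S 1 z = z)
    (hSrec : ∀ (k : ℤ) (z : ℝ), S k z = z * S (k - 1) z - S (k - 2) z)
    (m : ℤ) (hm : 1 ≤ m) (x : ℝ)
    (hx4 : x ^ 2 ≤ 4)
    (hx : 2 + 2 * (m : ℝ) / ((m : ℝ) + 1) < x ^ 2) :
    ∃! y₀ : ℝ, 2 < y₀ ∧
      S m (chebAlpha x y₀) + (1 - y₀) * S (m - 1) (chebAlpha x y₀) = 1 := by
  obtain ⟨n, rfl⟩ : ∃ n : ℕ, m = n + 1 := ⟨(m - 1).toNat, by omega⟩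
  have hS := chebyshevS_eval_unique S hS0 hS1 hSrec
  set d : ℝ := 4 - x ^ 2 with hd_def
  have hd : 0 ≤ d := by linarith
  have hd' : d * (n + 2) < 2 := by
    have h : (0 : ℝ) < n + 1 + 1 := by positivity
    push_cast at hx
    rw [← lt_sub_iff_add_lt', div_lt_iff₀ h] at hx
    linarith
  have hα (t : ℝ) : chebAlpha x (t + 2) = t * (t + d) + 2 := by
    rw [chebAlpha, hd_def]; ring
  have hiff (t : ℝ) (ht : 0 < t) :
      S (n + 1) (chebAlpha x (t + 2)) + (1 - (t + 2)) * S (n + 1 - 1) (chebAlpha x (t + 2)) = 1 ↔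
        (t * (t + d) + d) * ((Polynomial.Chebyshev.S ℝ (n + 1)).eval (t * (t + d) + 2) +
          (Polynomial.Chebyshev.S ℝ n).eval (t * (t + d) + 2)) = 4 - d := by
    have hS' := hS (n + 1) (t * (t + d) + 2)
    push_cast at hS'
    have hs : 0 < t * (t + d) := by positivity
    obtain ⟨⟨h1, -⟩, h3, -⟩ :=
      chebyshevS_eval_mono n (z := t * (t + d) + 2) (by linarith) le_rfl
    have hsq := congrArg (Polynomial.eval (t * (t + d) + 2))
      (Polynomial.Chebyshev.S_sq_add_S_sq ℝ n)
    simp only [Polynomial.eval_sub, Polynomial.eval_add, Polynomial.eval_mul, Polynomial.eval_pow,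
      Polynomial.eval_X, Polynomial.eval_one] at hsq
    rw [hα, add_sub_cancel_right, hS n, hS']
    exact add_mul_eq_one_iff ht hd (by linarith) (by linarith) (by linear_combination hsq)
  obtain ⟨t, ⟨ht, htK⟩, huniq⟩ := existsUnique_chebyshevS_eval n hd hd'
  refine ⟨t + 2, ⟨by linarith, (hiff t ht).2 htK⟩, fun y ⟨hy, hy1⟩ ↦ ?_⟩
  have hy0 : 0 < y - 2 := by linarith
  rw [← huniq (y - 2) ⟨hy0, (hiff _ hy0).1 (by rwa [sub_add_cancel])⟩, sub_add_cancel]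
end
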